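/- arXiv:2201.05250 — 11 statements merged into one kernel-verified Lean document; each statement's English description precedes it below -/
import Mathlib

section
/- Let φ^ν, φ : ℝⁿ → ℝ ∪ {+∞}, where φ is proper (not identically +∞), and suppose φ^ν epi-converges to φ. Let ε^ν ≥ 0 with ε^ν → 0. If for each ν the point x^ν satisfies φ^ν(x^ν) < +∞ and φ^ν(x^ν) ≤ inf φ^ν + ε^ν, and x^ν → x̄ along some infinite subset N of ℕ, then x̄ is a minimizer of φ, i.e., φ(x̄) ≤ φ(x) for all x ∈ ℝⁿ. -/
open Filter Topology
open scoped Classical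

noncomputable section

/-- Epi-convergence of a sequence of extended-real-valued functions. -/
def EpiConverges {E : Type*} [TopologicalSpace E] (g : ℕ → E → EReal) (g0 : E → EReal) : Prop :=
  (∀ (z : ℕ → E) (z0 : E), Tendsto z atTop (𝓝 z0) →
      g0 z0 ≤ liminf (fun ν => g ν (z ν)) atTop) ∧
  (∀ z0 : E, ∃ z : ℕ → E, Tendsto z atTop (𝓝 z0) ∧
      limsup (fun ν => g ν (z ν)) atTop ≤ g0 z0)

/-- Painlevé–Kuratowski set-convergence of a sequence of sets. -/
def SetConverges {E : Type*} [TopologicalSpace E] (C : ℕ → Set E) (C0 : Set E) : Prop :=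
  (∀ (N : ℕ → ℕ) (x : ℕ → E) (x0 : E), StrictMono N → (∀ k, x k ∈ C (N k)) →
      Tendsto x atTop (𝓝 x0) → x0 ∈ C0) ∧
  (∀ x0 ∈ C0, ∃ x : ℕ → E, (∀ ν, x ν ∈ C ν) ∧ Tendsto x atTop (𝓝 x0))

/-- The epigraph of an extended-real-valued function. -/
def EpiSet {E : Type*} (g : E → EReal) : Set (E × ℝ) := {p | g p.1 ≤ (p.2 : EReal)}

/-- A sequence converging along a subsequence extends to a full convergent sequence by putting
the limit at the remaining indices. -/
theorem tendsto_ite_mem_range_of_tendsto_comp {E : Type*} [TopologicalSpace E] {N : ℕ → ℕ}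
    (hN : StrictMono N) {x : ℕ → E} {a : E} (hx : Tendsto (fun k => x (N k)) atTop (𝓝 a)) :
    Tendsto (fun ν => if ν ∈ Set.range N then x ν else a) atTop (𝓝 a) := by
  refine tendsto_def.2 fun U hU => ?_
  obtain ⟨K, hK⟩ := eventually_atTop.1 (hx.eventually_mem hU)
  filter_upwards [eventually_ge_atTop (N K)] with ν hν
  by_cases h : ν ∈ Set.range N
  · obtain ⟨k, rfl⟩ := h
    simpa using hK k (hN.le_iff_le.1 hν)
  · simpa only [Set.mem_preimage, if_neg h] using mem_of_mem_nhds hU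

/-- cluster points of near-minimizers of epi-convergent approximations
with vanishing tolerances are minimizers of the limit function. -/
theorem cluster_points_of_near_minimizers
    (n : ℕ)
    (φ : (Fin n → ℝ) → EReal) (φν : ℕ → (Fin n → ℝ) → EReal)
    (hφbot : ∀ x, φ x ≠ ⊥) (hφνbot : ∀ ν x, φν ν x ≠ ⊥)
    (hproper : ∃ x, φ x ≠ ⊤)
    (hepi : EpiConverges φν φ)
    (ε : ℕ → ℝ) (hε0 : ∀ ν, 0 ≤ ε ν) (hε : Tendsto ε atTop (𝓝 0))
    (x : ℕ → Fin n → ℝ)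
    (hfin : ∀ ν, φν ν (x ν) < ⊤)
    (hmin : ∀ ν, φν ν (x ν) ≤ (⨅ y, φν ν y) + (ε ν : EReal))
    (N : ℕ → ℕ) (hN : StrictMono N)
    (xb : Fin n → ℝ) (hx : Tendsto (fun k => x (N k)) atTop (𝓝 xb)) :
    ∀ y, φ xb ≤ φ y := by
  intro y
  by_contra! hlt
  obtain ⟨a, hya, hax⟩ := EReal.lt_iff_exists_real_btwn.1 hlt
  obtain ⟨b, hab, hbx⟩ := EReal.lt_iff_exists_real_btwn.1 hax
  obtain ⟨w, -, hw⟩ := hepi.2 y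
  have hz := hepi.1 _ xb (tendsto_ite_mem_range_of_tendsto_comp hN hx)
  have hupper := eventually_lt_of_limsup_lt (hw.trans_lt hya)
  have hlower := eventually_lt_of_lt_liminf (hbx.trans_le hz)
  have hsmall := hε.eventually_lt_const (sub_pos.2 (EReal.coe_lt_coe_iff.1 hab))
  obtain ⟨k, hk_upper, hk_lower, hk_small⟩ :=
    (hN.tendsto_atTop.eventually (hupper.and (hlower.and hsmall))).exists
  rw [if_pos (Set.mem_range_self k)] at hk_lower
  have hk : (b : EReal) < ((a + ε (N k) : ℝ) : EReal) :=
    calc (b : EReal) < φν (N k) (x (N k)) := hk_lower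
      _ ≤ (⨅ u, φν (N k) u) + (ε (N k) : EReal) := hmin _
      _ ≤ (a : EReal) + (ε (N k) : EReal) := by
        gcongr
        exact (iInf_le _ (w (N k))).trans hk_upper.le
      _ = ((a + ε (N k) : ℝ) : EReal) := (EReal.coe_add _ _).symm
  linarith [EReal.coe_lt_coe_iff.1 hk]
end
end

section
/- Let X, X^ν ⊂ ℝⁿ be nonempty closed sets with X^ν set-converging to X; let h, h^ν : ℝᵐ → ℝ ∪ {+∞} be proper, lsc, convex with h^ν epi-converging to h; let F, F^ν : ℝⁿ → ℝᵐ be locally Lipschitz and assume that whenever x^ν ∈ X^ν converges to x ∈ X, one has F^ν(x^ν) → F(x). Define φ(x) = h(F(x)) if x ∈ X and +∞ otherwise, and φ^ν(x) = h^ν(F^ν(x)) if x ∈ X^ν and +∞ otherwise. Then for every sequence x^ν → x in ℝⁿ, liminf_ν φ^ν(x^ν) ≥ φ(x). -/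
open Filter Topology
open scoped Classical

noncomputable section

/-- the liminf-condition for the composite functions
φ^ν = ι_{X^ν} + h^ν ∘ F^ν relative to φ = ι_X + h ∘ F. -/
theorem composite_liminf_condition
    (n m : ℕ)
    (X : Set (Fin n → ℝ)) (Xν : ℕ → Set (Fin n → ℝ))
    (hXne : X.Nonempty) (hXcl : IsClosed X)
    (hXνne : ∀ ν, (Xν ν).Nonempty) (hXνcl : ∀ ν, IsClosed (Xν ν))
    (hXconv : SetConverges Xν X)
    (h : (Fin m → ℝ) → EReal) (hν : ℕ → (Fin m → ℝ) → EReal)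
    (hbot : ∀ z, h z ≠ ⊥) (hνbot : ∀ ν z, hν ν z ≠ ⊥)
    (hproper : ∃ z, h z ≠ ⊤) (hνproper : ∀ ν, ∃ z, hν ν z ≠ ⊤)
    (hlsc : IsClosed (EpiSet h)) (hνlsc : ∀ ν, IsClosed (EpiSet (hν ν)))
    (hcvx : Convex ℝ (EpiSet h)) (hνcvx : ∀ ν, Convex ℝ (EpiSet (hν ν)))
    (hepi : EpiConverges hν h)
    (F : (Fin n → ℝ) → (Fin m → ℝ)) (Fν : ℕ → (Fin n → ℝ) → (Fin m → ℝ))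
    (hF : LocallyLipschitz F) (hFν : ∀ ν, LocallyLipschitz (Fν ν))
    (hFconv : ∀ (x : ℕ → Fin n → ℝ) (x0 : Fin n → ℝ), (∀ ν, x ν ∈ Xν ν) → x0 ∈ X →
      Tendsto x atTop (𝓝 x0) → Tendsto (fun ν => Fν ν (x ν)) atTop (𝓝 (F x0))) :
    ∀ (x : ℕ → Fin n → ℝ) (x0 : Fin n → ℝ), Tendsto x atTop (𝓝 x0) →
      (if x0 ∈ X then h (F x0) else ⊤) ≤
        liminf (fun ν => if x ν ∈ Xν ν then hν ν (Fν ν (x ν)) else ⊤) atTop := by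
  intro x x0 hx
  by_cases hx0 : x0 ∈ X
  · obtain ⟨y, hyX, hy⟩ := hXconv.2 x0 hx0
    have hw : Tendsto (fun ν => if x ν ∈ Xν ν then x ν else y ν) atTop (𝓝 x0) :=
      hx.if' hy
    have hwX : ∀ ν, (if x ν ∈ Xν ν then x ν else y ν) ∈ Xν ν := by
      intro ν
      split_ifs with hmem
      exacts [hmem, hyX ν]
    rw [if_pos hx0]
    refine (hepi.1 _ _ (hFconv _ x0 hwX hx0 hw)).trans
      (liminf_le_liminf (Eventually.of_forall fun ν => ?_))
    by_cases hmem : x ν ∈ Xν ν <;> simp [hmem]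
  · have hout : ∀ᶠ ν in atTop, x ν ∉ Xν ν := by
      by_contra hfreq
      obtain ⟨N, hN, hNX⟩ := extraction_of_frequently_atTop (not_not.mp (mt not_frequently.mp hfreq))
      exact hx0 (hXconv.1 N (x ∘ N) x0 hN hNX (hx.comp hN.tendsto_atTop))
    rw [if_neg hx0, liminf_congr (hout.mono fun ν hmem => if_neg hmem), liminf_const]
end
end

section
/- (Epi-convergence under condition (a) of Theorem 1: real-valuedness.) Let X, X^ν ⊂ ℝⁿ be nonempty closed sets with X^ν set-converging to X; let h : ℝᵐ → ℝ be a (finite-valued) convex function and h^ν : ℝᵐ → ℝ ∪ {+∞} proper, lsc, convex with h^ν epi-converging to h; let F, F^ν : ℝⁿ → ℝᵐ be locally Lipschitz and assume that whenever x^ν ∈ X^ν converges to x ∈ X, one has F^ν(x^ν) → F(x). Define φ(x) = h(F(x)) if x ∈ X and +∞ otherwise, and φ^ν(x) = h^ν(F^ν(x)) if x ∈ X^ν and +∞ otherwise. Then φ^ν epi-converges to φ. -/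
open Filter Topology
open scoped Classical

noncomputable section

/-- A point in the interior of the convex hull of finitely many points stays in the convex hull
when it and these points are slightly perturbed. -/
theorem eventually_mem_convexHull_range {α ι E : Type*} [Finite ι] [Nonempty ι]
    [NormedAddCommGroup E] [NormedSpace ℝ E] {l : Filter α} {b : ι → E} {w : E}
    (hw : w ∈ interior (convexHull ℝ (Set.range b))) {a : α → ι → E} {y : α → E}
    (ha : ∀ i, Tendsto (fun ν => a ν i) l (𝓝 (b i))) (hy : Tendsto y l (𝓝 w)) :
    ∀ᶠ ν in l, y ν ∈ convexHull ℝ (Set.range (a ν)) := by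
  obtain ⟨δ, hδ, hball⟩ := Metric.mem_nhds_iff.1 (mem_interior_iff_mem_nhds.1 hw)
  have hδ4 : 0 < δ / 4 := by positivity
  have ha' : ∀ᶠ ν in l, ∀ i, dist (a ν i) (b i) < δ / 4 :=
    eventually_all.2 fun i => Metric.tendsto_nhds.1 (ha i) _ hδ4
  filter_upwards [ha', Metric.tendsto_nhds.1 hy _ hδ4] with ν haν hyν
  by_contra hmem
  obtain ⟨f, u, hfa, hfy⟩ := geometric_hahn_banach_closed_point (convex_convexHull ℝ _)
    ((Set.finite_range (a ν)).isClosed_convexHull ℝ) hmem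
  have hfa' : ∀ i, f (a ν i) < u := fun i => hfa _ (subset_convexHull ℝ _ ⟨i, rfl⟩)
  have hbound : ∀ v : E, ‖v‖ < δ / 4 → |f v| ≤ ‖f‖ * (δ / 4) := fun v hv =>
    (f.le_opNorm v).trans (mul_le_mul_of_nonneg_left hv.le (norm_nonneg f))
  have hfpos : 0 < ‖f‖ := by
    refine norm_pos_iff.2 fun hf => ?_
    have := hfa' (Classical.arbitrary ι)
    simp only [hf, zero_apply] at this hfy
    linarith
  have hhull : ∀ x ∈ convexHull ℝ (Set.range b), f x ≤ u + ‖f‖ * (δ / 4) := by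
    refine convexHull_min (t := {x | f x ≤ u + ‖f‖ * (δ / 4)}) ?_
      (convex_halfSpace_le f.toLinearMap.isLinear _)
    rintro _ ⟨i, rfl⟩
    have h1 := (abs_le.1 (hbound (a ν i - b i) (by simpa [dist_eq_norm] using haν i))).1
    rw [map_sub] at h1
    have h2 := hfa' i
    simp only [Set.mem_ofPred_eq]
    linarith
  have hyw := (abs_le.1 (hbound (y ν - w) (by simpa [dist_eq_norm] using hyν))).2
  rw [map_sub] at hyw
  obtain ⟨v, hv, hfv⟩ := f.exists_lt_apply_of_lt_opNorm (half_lt_self hfpos)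
  have hdir : ∀ v : E, ‖v‖ < 1 → δ * f v ≤ ‖f‖ * (δ / 2) := by
    intro v hv
    have hin : w + δ • v ∈ Metric.ball w δ := by
      rw [Metric.mem_ball, dist_eq_norm, add_sub_cancel_left, norm_smul, Real.norm_of_nonneg hδ.le]
      nlinarith
    have := hhull _ (hball hin)
    rw [map_add, map_smul, smul_eq_mul] at this
    linarith
  have h1 := hdir v hv
  have h2 := hdir (-v) (by rwa [norm_neg])
  rw [map_neg] at h2
  rw [Real.norm_eq_abs] at hfv
  have h3 : δ * |f v| ≤ ‖f‖ * (δ / 2) := by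
    rcases abs_cases (f v) with ⟨h, _⟩ | ⟨h, _⟩ <;> rw [h] <;> assumption
  nlinarith

theorem convex_sublevel_of_convex_epiSet {E : Type*} [AddCommGroup E] [Module ℝ E] {g : E → EReal}
    (hg : Convex ℝ (EpiSet g)) (c : ℝ) : Convex ℝ {z | g z ≤ (c : EReal)} := by
  intro x hx y hy s t hs ht hst
  have := @hg (x, c) hx (y, c) hy s t hs ht hst
  simpa [EpiSet, ← add_mul, hst] using this

/-- Epi-convergence of convex functions to a finite-valued convex function gives the upper half of
continuous convergence. -/
theorem EpiConverges.limsup_le_of_convex {E : Type*} [NormedAddCommGroup E] [NormedSpace ℝ E]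
    [FiniteDimensional ℝ E] {g : ℕ → E → EReal} {h : E → ℝ}
    (hg : EpiConverges g (fun z => ((h z : ℝ) : EReal))) (hgc : ∀ ν, Convex ℝ (EpiSet (g ν)))
    (hh : ConvexOn ℝ Set.univ h) {w : E} {y : ℕ → E} (hy : Tendsto y atTop (𝓝 w)) :
    limsup (fun ν => g ν (y ν)) atTop ≤ (h w : EReal) := by
  refine EReal.le_of_forall_lt_iff_le.1 fun c hc => ?_
  have hcont : Continuous h := by
    simpa [continuousOn_univ] using hh.continuousOn isOpen_univ
  have hnhds : {z | h z < c} ∈ 𝓝 w :=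
    (isOpen_lt hcont continuous_const).mem_nhds (EReal.coe_lt_coe_iff.1 hc)
  obtain ⟨b, hwb, hb⟩ := exists_mem_interior_convexHull_affineBasis hnhds
  choose a ha hga using fun i => hg.2 (b i)
  have hlt : ∀ᶠ ν in atTop, ∀ i, g ν (a i ν) < (c : EReal) := by
    refine eventually_all.2 fun i => eventually_lt_of_limsup_lt ((hga i).trans_lt ?_)
    exact EReal.coe_lt_coe_iff.2 (hb (subset_convexHull ℝ _ ⟨i, rfl⟩))
  refine limsup_le_of_le (h := ?_)
  filter_upwards [hlt, eventually_mem_convexHull_range (a := fun ν i => a i ν) hwb ha hy]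
    with ν hν hmem
  refine convexHull_min ?_ (convex_sublevel_of_convex_epiSet (hgc ν) c) hmem
  rintro _ ⟨i, rfl⟩
  exact (hν i).le

/-- A limit of points that frequently lie in set-converging sets lies in the limit set. -/
theorem SetConverges.mem_of_frequently {E : Type*} [TopologicalSpace E] {C : ℕ → Set E}
    {C0 : Set E} (hC : SetConverges C C0) {z : ℕ → E} {z0 : E} (hz : Tendsto z atTop (𝓝 z0))
    (hmem : ∃ᶠ ν in atTop, z ν ∈ C ν) : z0 ∈ C0 := by
  obtain ⟨N, hN, hNmem⟩ := extraction_of_frequently_atTop hmem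
  exact hC.1 N (z ∘ N) z0 hN hNmem (hz.comp hN.tendsto_atTop)

/-- epi-convergence of the composite functions under condition (a):
the limiting function h is real-valued (and convex). -/
theorem composite_epi_convergence_real_valued
    (n m : ℕ)
    (X : Set (Fin n → ℝ)) (Xν : ℕ → Set (Fin n → ℝ))
    (hXne : X.Nonempty) (hXcl : IsClosed X)
    (hXνne : ∀ ν, (Xν ν).Nonempty) (hXνcl : ∀ ν, IsClosed (Xν ν))
    (hXconv : SetConverges Xν X)
    (h : (Fin m → ℝ) → ℝ) (hcvx : ConvexOn ℝ Set.univ h)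
    (hν : ℕ → (Fin m → ℝ) → EReal)
    (hνbot : ∀ ν z, hν ν z ≠ ⊥) (hνproper : ∀ ν, ∃ z, hν ν z ≠ ⊤)
    (hνlsc : ∀ ν, IsClosed (EpiSet (hν ν))) (hνcvx : ∀ ν, Convex ℝ (EpiSet (hν ν)))
    (hepi : EpiConverges hν (fun z => ((h z : ℝ) : EReal)))
    (F : (Fin n → ℝ) → (Fin m → ℝ)) (Fν : ℕ → (Fin n → ℝ) → (Fin m → ℝ))
    (hF : LocallyLipschitz F) (hFν : ∀ ν, LocallyLipschitz (Fν ν))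
    (hFconv : ∀ (x : ℕ → Fin n → ℝ) (x0 : Fin n → ℝ), (∀ ν, x ν ∈ Xν ν) → x0 ∈ X →
      Tendsto x atTop (𝓝 x0) → Tendsto (fun ν => Fν ν (x ν)) atTop (𝓝 (F x0))) :
    EpiConverges
      (fun ν x => if x ∈ Xν ν then hν ν (Fν ν x) else ⊤)
      (fun x => if x ∈ X then ((h (F x) : ℝ) : EReal) else ⊤) := by
  refine ⟨fun z z0 hz => ?_, fun z0 => ?_⟩
  · by_cases hz0 : z0 ∈ X
    · obtain ⟨p, hpmem, hp⟩ := hXconv.2 z0 hz0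
      have hx : Tendsto (fun ν => if z ν ∈ Xν ν then z ν else p ν) atTop (𝓝 z0) := hz.if' hp
      have hlim := hepi.1 _ _ (hFconv _ z0 (fun ν => by split_ifs with hmem; exacts [hmem, hpmem ν])
        hz0 hx)
      simp only [if_pos hz0]
      refine hlim.trans (liminf_le_liminf (Eventually.of_forall fun ν => ?_))
      by_cases hmem : z ν ∈ Xν ν <;> simp [hmem]
    · have hev : ∀ᶠ ν in atTop, z ν ∉ Xν ν :=
        not_frequently.1 fun hfreq => hz0 (hXconv.mem_of_frequently hz hfreq)
      refine le_liminf_of_le (h := ?_)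
      filter_upwards [hev] with ν hmem
      simp [hmem]
  · by_cases hz0 : z0 ∈ X
    · obtain ⟨p, hpmem, hp⟩ := hXconv.2 z0 hz0
      refine ⟨p, hp, ?_⟩
      simp only [hpmem, hz0, if_true]
      exact hepi.limsup_le_of_convex hνcvx hcvx (hFconv p z0 hpmem hz0 hp)
    · exact ⟨fun _ => z0, tendsto_const_nhds, by simp [hz0]⟩
end
end

section
/- (Epi-convergence under condition (b) of Theorem 1: pointwise convergence.) Let X, X^ν ⊂ ℝⁿ be nonempty closed sets with X ⊂ X^ν for each ν and X^ν set-converging to X; let h, h^ν : ℝᵐ → ℝ ∪ {+∞} be proper, lsc, convex with h^ν epi-converging to h and h^ν(z) → h(z) for every z in the boundary of dom h (i.e., every z ∈ dom h not in the interior of dom h); let F, F^ν : ℝⁿ → ℝᵐ be locally Lipschitz with F^ν(x) = F(x) for all x ∈ X, and assume that whenever x^ν ∈ X^ν converges to x ∈ X, one has F^ν(x^ν) → F(x). Define φ(x) = h(F(x)) if x ∈ X and +∞ otherwise, and φ^ν(x) = h^ν(F^ν(x)) if x ∈ X^ν and +∞ otherwise. Then φ^ν epi-converges to φ. -/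
open Filter Topology
open scoped Classical

noncomputable section

/-- A point well inside the convex hull of `w` stays in the hull when the `w i` move slightly. -/
lemma mem_convexHull_range_of_ball_subset {ι E : Type*} [Finite ι] [NormedAddCommGroup E]
    [NormedSpace ℝ E] {w v : ι → E} {z : E} {r : ℝ} (hr : 0 < r)
    (hw : Metric.ball z r ⊆ convexHull ℝ (Set.range w)) (hv : ∀ i, ‖v i - w i‖ ≤ r / 2) :
    z ∈ convexHull ℝ (Set.range v) := by
  by_contra hz
  obtain ⟨f, u, hfz, hfu⟩ := geometric_hahn_banach_point_closed (convex_convexHull ℝ _)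
    ((Set.finite_range v).isClosed_convexHull ℝ) hz
  have hsep : ∀ i, f z < f (v i) := fun i =>
    hfz.trans (hfu _ (subset_convexHull ℝ _ ⟨i, rfl⟩))
  obtain ⟨i₀⟩ : Nonempty ι := by
    rw [← Set.range_nonempty_iff_nonempty (f := w), ← convexHull_nonempty_iff (𝕜 := ℝ)]
    exact ⟨z, hw (Metric.mem_ball_self hr)⟩
  have hf : 0 < ‖f‖ := by
    rw [norm_pos_iff]
    rintro rfl
    simpa using hsep i₀
  obtain ⟨y, hy, hfy⟩ : ∃ y : E, ‖y‖ < 1 ∧ f y < -(‖f‖ / 2) := by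
    obtain ⟨y, hy, hfy⟩ := f.exists_lt_apply_of_lt_opNorm (half_lt_self hf)
    rw [Real.norm_eq_abs, lt_abs] at hfy
    rcases hfy with hfy | hfy
    · exact ⟨-y, by simpa using hy, by simpa using hfy⟩
    · exact ⟨y, hy, by linarith⟩
  have hp : z + r • y ∈ convexHull ℝ (Set.range w) := hw <| by
    rw [Metric.mem_ball, dist_eq_norm, add_sub_cancel_left, norm_smul, Real.norm_of_nonneg hr.le]
    nlinarith
  obtain ⟨_, ⟨i, rfl⟩, hi⟩ := (f.toLinearMap.concaveOn convex_univ).exists_le_of_mem_convexHull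
    (Set.subset_univ _) hp
  have hi : f (w i) ≤ f z + r * f y := by simpa using hi
  have hvi : f (v i) - f (w i) ≤ ‖f‖ * (r / 2) := by
    rw [← map_sub]
    exact (le_abs_self _).trans <| (f.le_opNorm _).trans <| by gcongr; exact hv i
  nlinarith [hsep i]

/-- Convex sets whose inner limit contains `C` eventually contain each interior point of `C`. -/
lemma eventually_mem_of_mem_interior {E : Type*} [NormedAddCommGroup E] [NormedSpace ℝ E]
    [FiniteDimensional ℝ E] {C : Set E} {Cν : ℕ → Set E} (hcvx : ∀ ν, Convex ℝ (Cν ν))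
    (hinner : ∀ x ∈ C, ∃ y : ℕ → E, Tendsto y atTop (𝓝 x) ∧ ∀ᶠ ν in atTop, y ν ∈ Cν ν)
    {z : E} (hz : z ∈ interior C) : ∀ᶠ ν in atTop, z ∈ Cν ν := by
  obtain ⟨b, hzb, hbC⟩ := exists_mem_interior_convexHull_affineBasis (mem_interior_iff_mem_nhds.1 hz)
  obtain ⟨r, hr, hball⟩ := Metric.mem_nhds_iff.1 (mem_interior_iff_mem_nhds.1 hzb)
  choose y hy hyC using fun i => hinner (b i) (hbC (subset_convexHull ℝ _ ⟨i, rfl⟩))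
  have hclose : ∀ᶠ ν in atTop, ∀ i, ‖y i ν - b i‖ ≤ r / 2 := by
    rw [eventually_all]
    intro i
    filter_upwards [Metric.tendsto_nhds.1 (hy i) (r / 2) (half_pos hr)] with ν hν
    rw [← dist_eq_norm]
    exact hν.le
  filter_upwards [hclose, eventually_all.2 hyC] with ν hν hνC
  refine convexHull_min ?_ (hcvx ν) (mem_convexHull_range_of_ball_subset hr hball hν)
  rintro _ ⟨i, rfl⟩
  exact hνC i

lemma convex_lt_of_convex_epiSet {E : Type*} [AddCommGroup E] [Module ℝ E] {g : E → EReal}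
    (hg : Convex ℝ (EpiSet g)) (c : EReal) : Convex ℝ {x | g x < c} := by
  intro x hx y hy s t hs ht hst
  obtain ⟨a, hxa, hac⟩ := EReal.lt_iff_exists_real_btwn.1 hx
  obtain ⟨b, hyb, hbc⟩ := EReal.lt_iff_exists_real_btwn.1 hy
  have hmax : ((max a b : ℝ) : EReal) < c := by
    rcases max_choice a b with h | h <;> rwa [h]
  have hmem := hg (x := (x, max a b)) (y := (y, max a b))
    (hxa.le.trans (EReal.coe_le_coe (le_max_left a b)))
    (hyb.le.trans (EReal.coe_le_coe (le_max_right a b))) hs ht hst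
  have hle : g (s • x + t • y) ≤ ((s • max a b + t • max a b : ℝ) : EReal) := hmem
  rw [← add_smul, hst, one_smul] at hle
  exact hle.trans_lt hmax

lemma convexOn_toReal_of_convex_epiSet {E : Type*} [AddCommGroup E] [Module ℝ E] {g : E → EReal}
    (hg : Convex ℝ (EpiSet g)) (hbot : ∀ x, g x ≠ ⊥) :
    ConvexOn ℝ {x | g x ≠ ⊤} fun x => (g x).toReal := by
  refine ⟨by simpa only [lt_top_iff_ne_top] using convex_lt_of_convex_epiSet hg ⊤, ?_⟩
  intro x hx y hy s t hs ht hst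
  have hmem := hg (x := (x, (g x).toReal)) (y := (y, (g y).toReal))
    (EReal.le_coe_toReal hx) (EReal.le_coe_toReal hy) hs ht hst
  have hle : g (s • x + t • y) ≤ ((s • (g x).toReal + t • (g y).toReal : ℝ) : EReal) := hmem
  exact EReal.toReal_le_toReal hle (hbot _) (EReal.coe_ne_top _)

/-- Epi-convergence of convex functions bounds the limsup at interior points of the domain. -/
lemma EpiConverges.limsup_le_of_mem_interior {E : Type*} [NormedAddCommGroup E] [NormedSpace ℝ E]
    [FiniteDimensional ℝ E] {g : E → EReal} {gν : ℕ → E → EReal} (hepi : EpiConverges gν g)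
    (hbot : ∀ x, g x ≠ ⊥) (hcvx : Convex ℝ (EpiSet g)) (hνcvx : ∀ ν, Convex ℝ (EpiSet (gν ν)))
    {z : E} (hz : z ∈ interior {x | g x ≠ ⊤}) : limsup (fun ν => gν ν z) atTop ≤ g z := by
  refine le_of_forall_gt_imp_ge_of_dense fun c hc => ?_
  obtain ⟨a, hza, hac⟩ := EReal.lt_iff_exists_real_btwn.1 hc
  have hdom : {x | g x ≠ ⊤} ∈ 𝓝 z := mem_interior_iff_mem_nhds.1 hz
  have hcont : ContinuousAt (fun x => (g x).toReal) z :=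
    (convexOn_toReal_of_convex_epiSet hcvx hbot).continuousOn_interior.continuousAt
      (isOpen_interior.mem_nhds hz)
  have hlt {x : E} (hx : g x ≠ ⊤) : (g x).toReal < a ↔ g x < a := by
    rw [← EReal.coe_lt_coe_iff, EReal.coe_toReal hx (hbot x)]
  have hint : z ∈ interior {x | g x < a} := by
    rw [mem_interior_iff_mem_nhds]
    filter_upwards [hdom, hcont.eventually_lt_const ((hlt (mem_of_mem_nhds hdom)).2 hza)]
      with x hx hxa using (hlt hx).1 hxa
  have hev : ∀ᶠ ν in atTop, z ∈ {x | gν ν x < a} := by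
    refine eventually_mem_of_mem_interior (fun ν => convex_lt_of_convex_epiSet (hνcvx ν) a) ?_ hint
    intro x hx
    obtain ⟨y, hy, hyx⟩ := hepi.2 x
    exact ⟨y, hy, eventually_lt_of_limsup_lt (hyx.trans_lt hx)⟩
  exact (limsup_le_of_le (h := hev.mono fun ν hν => le_of_lt hν)).trans hac.le

/-- epi-convergence of the composite functions under condition (b):
pointwise convergence of h^ν to h on the boundary of dom h, with F^ν = F on X and X ⊂ X^ν. -/
theorem composite_epi_convergence_pointwise
    (n m : ℕ)
    (X : Set (Fin n → ℝ)) (Xν : ℕ → Set (Fin n → ℝ))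
    (hXne : X.Nonempty) (hXcl : IsClosed X)
    (hXνne : ∀ ν, (Xν ν).Nonempty) (hXνcl : ∀ ν, IsClosed (Xν ν))
    (hXsub : ∀ ν, X ⊆ Xν ν)
    (hXconv : SetConverges Xν X)
    (h : (Fin m → ℝ) → EReal) (hν : ℕ → (Fin m → ℝ) → EReal)
    (hbot : ∀ z, h z ≠ ⊥) (hνbot : ∀ ν z, hν ν z ≠ ⊥)
    (hproper : ∃ z, h z ≠ ⊤) (hνproper : ∀ ν, ∃ z, hν ν z ≠ ⊤)
    (hlsc : IsClosed (EpiSet h)) (hνlsc : ∀ ν, IsClosed (EpiSet (hν ν)))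
    (hcvx : Convex ℝ (EpiSet h)) (hνcvx : ∀ ν, Convex ℝ (EpiSet (hν ν)))
    (hepi : EpiConverges hν h)
    (hbdry : ∀ z : Fin m → ℝ, h z ≠ ⊤ → z ∉ interior {w | h w ≠ ⊤} →
      Tendsto (fun ν => hν ν z) atTop (𝓝 (h z)))
    (F : (Fin n → ℝ) → (Fin m → ℝ)) (Fν : ℕ → (Fin n → ℝ) → (Fin m → ℝ))
    (hF : LocallyLipschitz F) (hFν : ∀ ν, LocallyLipschitz (Fν ν))
    (hFeq : ∀ ν, ∀ x ∈ X, Fν ν x = F x)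
    (hFconv : ∀ (x : ℕ → Fin n → ℝ) (x0 : Fin n → ℝ), (∀ ν, x ν ∈ Xν ν) → x0 ∈ X →
      Tendsto x atTop (𝓝 x0) → Tendsto (fun ν => Fν ν (x ν)) atTop (𝓝 (F x0))) :
    EpiConverges
      (fun ν x => if x ∈ Xν ν then hν ν (Fν ν x) else ⊤)
      (fun x => if x ∈ X then h (F x) else ⊤) := by
  refine ⟨fun x x0 hx => ?_, fun x0 => ?_⟩
  · by_cases hx0 : x0 ∈ X
    · simp only [if_pos hx0]
      set y : ℕ → Fin n → ℝ := fun ν => if x ν ∈ Xν ν then x ν else x0 with hy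
      have hyX : ∀ ν, y ν ∈ Xν ν := by
        intro ν
        by_cases hxν : x ν ∈ Xν ν
        · simpa only [hy, if_pos hxν] using hxν
        · simpa only [hy, if_neg hxν] using hXsub ν hx0
      have hylim : Tendsto y atTop (𝓝 x0) := hx.if' tendsto_const_nhds
      refine (hepi.1 _ _ (hFconv y x0 hyX hx0 hylim)).trans (liminf_le_liminf ?_)
      refine Eventually.of_forall fun ν => ?_
      by_cases hxν : x ν ∈ Xν ν <;> simp [hy, hxν]
    · have hout : ∀ᶠ ν in atTop, x ν ∉ Xν ν := by
        by_contra hfreq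
        obtain ⟨N, hN, hxN⟩ := extraction_of_frequently_atTop (not_eventually.1 hfreq)
        exact hx0 (hXconv.1 N (x ∘ N) x0 hN (fun k => not_not.1 (hxN k))
          (hx.comp hN.tendsto_atTop))
      exact le_liminf_of_le (h := hout.mono fun ν hν => by simp [hν])
  · refine ⟨fun _ => x0, tendsto_const_nhds, ?_⟩
    by_cases hx0 : x0 ∈ X
    · simp only [hXsub _ hx0, hFeq _ _ hx0, hx0, if_true]
      by_cases htop : h (F x0) = ⊤
      · simp [htop]
      · by_cases hint : F x0 ∈ interior {w | h w ≠ ⊤}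
        · exact hepi.limsup_le_of_mem_interior hbot hcvx hνcvx hint
        · exact (hbdry _ htop hint).limsup_eq.le
    · simp [hx0]
end
end

section
/- (Epi-convergence under condition (c) of Theorem 1: monotonicity.) Let X, X^ν ⊂ ℝⁿ be nonempty closed sets with X ⊂ X^ν for each ν and X^ν set-converging to X; let h, h^ν : ℝᵐ → ℝ ∪ {+∞} be proper, lsc, convex with h^ν epi-converging to h, and suppose for each ν: h^ν(z) ≤ h^ν(z̄) whenever z ≤ z̄ componentwise, and h^ν(z) ≤ h(z) for all z ∈ ℝᵐ; let F, F^ν : ℝⁿ → ℝᵐ be locally Lipschitz with F^ν(x) ≤ F(x) componentwise for all x ∈ X, and assume that whenever x^ν ∈ X^ν converges to x ∈ X, one has F^ν(x^ν) → F(x). Define φ(x) = h(F(x)) if x ∈ X and +∞ otherwise, and φ^ν(x) = h^ν(F^ν(x)) if x ∈ X^ν and +∞ otherwise. Then φ^ν epi-converges to φ. -/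
open Filter Topology
open scoped Classical

noncomputable section

/-- epi-convergence of the composite functions under condition (c):
monotonicity of h^ν, h^ν ≤ h, X ⊂ X^ν, and F^ν ≤ F on X. -/
theorem composite_epi_convergence_monotone
    (n m : ℕ)
    (X : Set (Fin n → ℝ)) (Xν : ℕ → Set (Fin n → ℝ))
    (hXne : X.Nonempty) (hXcl : IsClosed X)
    (hXνne : ∀ ν, (Xν ν).Nonempty) (hXνcl : ∀ ν, IsClosed (Xν ν))
    (hXsub : ∀ ν, X ⊆ Xν ν)
    (hXconv : SetConverges Xν X)
    (h : (Fin m → ℝ) → EReal) (hν : ℕ → (Fin m → ℝ) → EReal)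
    (hbot : ∀ z, h z ≠ ⊥) (hνbot : ∀ ν z, hν ν z ≠ ⊥)
    (hproper : ∃ z, h z ≠ ⊤) (hνproper : ∀ ν, ∃ z, hν ν z ≠ ⊤)
    (hlsc : IsClosed (EpiSet h)) (hνlsc : ∀ ν, IsClosed (EpiSet (hν ν)))
    (hcvx : Convex ℝ (EpiSet h)) (hνcvx : ∀ ν, Convex ℝ (EpiSet (hν ν)))
    (hepi : EpiConverges hν h)
    (hmono : ∀ ν, ∀ z z' : Fin m → ℝ, z ≤ z' → hν ν z ≤ hν ν z')
    (hbelow : ∀ ν z, hν ν z ≤ h z)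
    (F : (Fin n → ℝ) → (Fin m → ℝ)) (Fν : ℕ → (Fin n → ℝ) → (Fin m → ℝ))
    (hF : LocallyLipschitz F) (hFν : ∀ ν, LocallyLipschitz (Fν ν))
    (hFle : ∀ ν, ∀ x ∈ X, Fν ν x ≤ F x)
    (hFconv : ∀ (x : ℕ → Fin n → ℝ) (x0 : Fin n → ℝ), (∀ ν, x ν ∈ Xν ν) → x0 ∈ X →
      Tendsto x atTop (𝓝 x0) → Tendsto (fun ν => Fν ν (x ν)) atTop (𝓝 (F x0))) :
    EpiConverges
      (fun ν x => if x ∈ Xν ν then hν ν (Fν ν x) else ⊤)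
      (fun x => if x ∈ X then h (F x) else ⊤) := by
  refine ⟨fun z z0 hz => ?_, fun z0 => ⟨fun _ => z0, tendsto_const_nhds, ?_⟩⟩
  · by_cases hz0 : z0 ∈ X
    · have hmem : ∀ ν, (if z ν ∈ Xν ν then z ν else z0) ∈ Xν ν := by
        intro ν
        split_ifs with hν
        · exact hν
        · exact hXsub ν hz0
      have hlim : Tendsto (fun ν => if z ν ∈ Xν ν then z ν else z0) atTop (𝓝 z0) :=
        hz.if' tendsto_const_nhds
      simp only [if_pos hz0]
      refine (hepi.1 _ _ (hFconv _ z0 hmem hz0 hlim)).trans ?_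
      refine liminf_le_liminf (Eventually.of_forall fun ν => ?_)
      by_cases hzν : z ν ∈ Xν ν <;> simp [hzν]
    · have hout : ∀ᶠ ν in atTop, z ν ∉ Xν ν := by
        by_contra hfreq
        obtain ⟨N, hN, hmem⟩ := extraction_of_frequently_atTop (not_eventually.1 hfreq)
        exact hz0 (hXconv.1 N (z ∘ N) z0 hN (fun k => not_not.1 (hmem k))
          (hz.comp hN.tendsto_atTop))
      have htop : (fun ν => if z ν ∈ Xν ν then hν ν (Fν ν (z ν)) else ⊤) =ᶠ[atTop]
          fun _ => (⊤ : EReal) := by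
        filter_upwards [hout] with ν hzν using if_neg hzν
      rw [liminf_congr htop, liminf_const]
      exact le_top
  · by_cases hz0 : z0 ∈ X
    · simp only [if_pos hz0]
      refine limsup_le_of_le (h := Eventually.of_forall fun ν => ?_)
      rw [if_pos (hXsub ν hz0)]
      exact (hmono ν _ _ (hFle ν z0 hz0)).trans (hbelow ν _)
    · simp [hz0]
end
end

section
/- Let f^ν, f : ℝⁿ → ℝ be (finite-valued) convex functions with f^ν epi-converging to f. Then for every sequence x^ν → x̄ in ℝⁿ: (i) f^ν(x^ν) → f(x̄); and (ii) for every choice of subgradients v^ν ∈ ∂f^ν(x^ν), the sequence {v^ν} is bounded and every cluster point of {v^ν} belongs to ∂f(x̄). -/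
open Filter Topology
open scoped RealInnerProductSpace

noncomputable section

/-- The (convex-analysis) subdifferential of a real-valued function. -/
def Subdiff {n : ℕ} (g : EuclideanSpace ℝ (Fin n) → ℝ) (z : EuclideanSpace ℝ (Fin n)) :
    Set (EuclideanSpace ℝ (Fin n)) :=
  {v | ∀ w, g z + ⟪v, w - z⟫ ≤ g w}

/-- Moving along the direction of `a` by a length `η` raises `⟪a, ·⟫` by `η * ‖a‖`. -/
theorem exists_norm_le_inner_eq {E : Type*} [NormedAddCommGroup E] [InnerProductSpace ℝ E]
    (a : E) {η : ℝ} (hη : 0 ≤ η) : ∃ h : E, ‖h‖ ≤ η ∧ ⟪a, h⟫ = η * ‖a‖ := by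
  rcases eq_or_ne a 0 with rfl | ha
  · exact ⟨0, by simpa using hη, by simp⟩
  · have hpos : 0 < ‖a‖ := norm_pos_iff.mpr ha
    refine ⟨(η / ‖a‖) • a, ?_, ?_⟩
    · rw [norm_smul, Real.norm_of_nonneg (by positivity), div_mul_cancel₀ _ hpos.ne']
    · rw [real_inner_smul_right, real_inner_self_eq_norm_sq]
      field_simp

/-- If the convex hull of finitely many points contains a ball, then the convex hull of any
perturbation of these points of size at most `η` contains the ball with radius smaller by `η`. -/
theorem ball_subset_convexHull_range_of_dist_le {E ι : Type*} [NormedAddCommGroup E]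
    [InnerProductSpace ℝ E] [CompleteSpace E] [Finite ι] {p q : ι → E} {x : E} {r η : ℝ}
    (hη : 0 ≤ η) (hp : Metric.ball x (r + η) ⊆ convexHull ℝ (Set.range p))
    (hpq : ∀ i, dist (p i) (q i) ≤ η) :
    Metric.ball x r ⊆ convexHull ℝ (Set.range q) := by
  intro y hy
  by_contra hyq
  obtain ⟨φ, u, hφq, hφy⟩ := geometric_hahn_banach_closed_point
    (convex_convexHull ℝ (Set.range q)) ((Set.finite_range q).isClosed_convexHull ℝ) hyq
  obtain ⟨a, rfl⟩ := (InnerProductSpace.toDual ℝ E).surjective φ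
  simp only [InnerProductSpace.toDual_apply_apply] at hφq hφy
  obtain ⟨h, hh, hah⟩ := exists_norm_le_inner_eq a hη
  have hmem : y + h ∈ convexHull ℝ (Set.range p) := by
    apply hp
    rw [Metric.mem_ball, dist_eq_norm] at hy ⊢
    calc ‖y + h - x‖ = ‖(y - x) + h‖ := by congr 1; abel
      _ ≤ ‖y - x‖ + ‖h‖ := norm_add_le _ _
      _ < r + η := by linarith
  have hconv : ConvexOn ℝ Set.univ fun z : E => ⟪a, z⟫ :=
    (innerₛₗ ℝ a).convexOn convex_univ
  obtain ⟨_, ⟨i, rfl⟩, hi⟩ := hconv.exists_ge_of_mem_convexHull (Set.subset_univ _) hmem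
  have hqi := hφq (q i) (subset_convexHull ℝ _ ⟨i, rfl⟩)
  have hdiff : ⟪a, p i - q i⟫ ≤ ‖a‖ * η :=
    (real_inner_le_norm _ _).trans
      (mul_le_mul_of_nonneg_left (by simpa [dist_eq_norm] using hpq i) (norm_nonneg a))
  rw [inner_sub_right] at hdiff
  simp only [inner_add_right] at hi
  linarith

/-- Epi-convergent convex functions are eventually bounded above, uniformly near a point, by any
number exceeding the value of the limit there. -/
theorem EpiConverges.exists_ball_eventually_lt {E : Type*} [NormedAddCommGroup E]
    [InnerProductSpace ℝ E] [FiniteDimensional ℝ E] {f : E → ℝ} {fν : ℕ → E → ℝ}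
    (hepi : EpiConverges (fun ν z => ((fν ν z : ℝ) : EReal)) (fun z => ((f z : ℝ) : EReal)))
    (hcvx : ConvexOn ℝ Set.univ f) (hνcvx : ∀ ν, ConvexOn ℝ Set.univ (fν ν))
    {x : E} {c : ℝ} (hc : f x < c) :
    ∃ r > 0, ∀ᶠ ν in atTop, ∀ y ∈ Metric.ball x r, fν ν y < c := by
  have hcont : Continuous f := hcvx.locallyLipschitz.continuous
  obtain ⟨b, hxb, hbc⟩ := exists_mem_interior_convexHull_affineBasis
    (hcont.continuousAt.eventually_lt continuousAt_const hc)
  obtain ⟨δ, hδ, hball⟩ := Metric.mem_nhds_iff.mp (mem_interior_iff_mem_nhds.mp hxb)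
  choose z hz hlim using fun i => hepi.2 (b i)
  refine ⟨δ / 2, by positivity, ?_⟩
  have hval : ∀ᶠ ν in atTop, ∀ i, fν ν (z i ν) < c := by
    refine eventually_all.mpr fun i => ?_
    have hbi : f (b i) < c := hbc (subset_convexHull ℝ _ ⟨i, rfl⟩)
    filter_upwards [eventually_lt_of_limsup_lt
      ((hlim i).trans_lt (EReal.coe_lt_coe_iff.mpr hbi))] with ν hν
    exact EReal.coe_lt_coe_iff.mp hν
  have hdist : ∀ᶠ ν in atTop, ∀ i, dist (z i ν) (b i) < δ / 2 :=
    eventually_all.mpr fun i => Metric.tendsto_nhds.mp (hz i) _ (by positivity)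
  filter_upwards [hval, hdist] with ν hν hd y hy
  have hy' := ball_subset_convexHull_range_of_dist_le (p := b) (q := fun i => z i ν)
    (η := δ / 2)
    (half_pos hδ).le (by rwa [add_halves]) (fun i => by rw [dist_comm]; exact (hd i).le) hy
  obtain ⟨_, ⟨i, rfl⟩, hi⟩ :=
    (hνcvx ν).exists_ge_of_mem_convexHull (Set.subset_univ _) hy'
  exact hi.trans_lt (hν i)

/-- Epi-convergent convex functions converge continuously. -/
theorem EpiConverges.tendsto_of_convexOn {E : Type*} [NormedAddCommGroup E]
    [InnerProductSpace ℝ E] [FiniteDimensional ℝ E] {f : E → ℝ} {fν : ℕ → E → ℝ}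
    (hepi : EpiConverges (fun ν z => ((fν ν z : ℝ) : EReal)) (fun z => ((f z : ℝ) : EReal)))
    (hcvx : ConvexOn ℝ Set.univ f) (hνcvx : ∀ ν, ConvexOn ℝ Set.univ (fν ν))
    {x : ℕ → E} {xb : E} (hx : Tendsto x atTop (𝓝 xb)) :
    Tendsto (fun ν => fν ν (x ν)) atTop (𝓝 (f xb)) := by
  refine tendsto_order.mpr ⟨fun c hc => ?_, fun c hc => ?_⟩
  · filter_upwards [eventually_lt_of_lt_liminf
      ((EReal.coe_lt_coe_iff.mpr hc).trans_le (hepi.1 x xb hx))] with ν hν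
    exact EReal.coe_lt_coe_iff.mp hν
  · obtain ⟨r, hr, hlt⟩ := hepi.exists_ball_eventually_lt hcvx hνcvx hc
    filter_upwards [hlt, hx (Metric.ball_mem_nhds xb hr)] with ν hν hxν
    exact hν _ hxν

/-- for epi-convergent finite-valued convex functions, function values
converge along convergent sequences and subgradients are bounded with all cluster
points in the subdifferential of the limit. -/
theorem convex_epi_convergence_subgradients
    (n : ℕ)
    (f : EuclideanSpace ℝ (Fin n) → ℝ) (fν : ℕ → EuclideanSpace ℝ (Fin n) → ℝ)
    (hcvx : ConvexOn ℝ Set.univ f) (hνcvx : ∀ ν, ConvexOn ℝ Set.univ (fν ν))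
    (hepi : EpiConverges (fun ν z => ((fν ν z : ℝ) : EReal)) (fun z => ((f z : ℝ) : EReal)))
    (x : ℕ → EuclideanSpace ℝ (Fin n)) (xb : EuclideanSpace ℝ (Fin n))
    (hx : Tendsto x atTop (𝓝 xb)) :
    Tendsto (fun ν => fν ν (x ν)) atTop (𝓝 (f xb)) ∧
    ∀ v : ℕ → EuclideanSpace ℝ (Fin n),
      (∀ ν, v ν ∈ Subdiff (fν ν) (x ν)) →
      Bornology.IsBounded (Set.range v) ∧
      ∀ vb, MapClusterPt vb atTop v → vb ∈ Subdiff f xb := by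
  have htend : ∀ {y : ℕ → EuclideanSpace ℝ (Fin n)} {yb : EuclideanSpace ℝ (Fin n)},
      Tendsto y atTop (𝓝 yb) → Tendsto (fun ν => fν ν (y ν)) atTop (𝓝 (f yb)) :=
    fun hy => hepi.tendsto_of_convexOn hcvx hνcvx hy
  refine ⟨htend hx, fun v hv => ⟨?_, fun vb hvb w => ?_⟩⟩
  · obtain ⟨r, hr, hlt⟩ := hepi.exists_ball_eventually_lt hcvx hνcvx (lt_add_one (f xb))
    have hbound : ∀ᶠ ν in atTop, ‖v ν‖ ≤ 4 / r := by
      filter_upwards [hlt, hx (Metric.ball_mem_nhds xb (half_pos hr)),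
        (htend hx).eventually_const_lt (sub_one_lt (f xb))] with ν hν hxν hlow
      obtain ⟨h, hh, hvh⟩ := exists_norm_le_inner_eq (v ν) (half_pos hr).le
      have hmem : x ν + h ∈ Metric.ball xb r := by
        rw [Set.mem_preimage, Metric.mem_ball, dist_eq_norm] at hxν
        rw [Metric.mem_ball, dist_eq_norm]
        calc ‖x ν + h - xb‖ = ‖(x ν - xb) + h‖ := by congr 1; abel
          _ ≤ ‖x ν - xb‖ + ‖h‖ := norm_add_le _ _
          _ < r := by linarith
      have hsub := hv ν (x ν + h)
      rw [add_sub_cancel_left, hvh] at hsub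
      have := hν _ hmem
      rw [le_div_iff₀ hr]
      linarith
    obtain ⟨C, hC⟩ := (isBoundedUnder_of_eventually_le hbound).bddAbove_range
    exact isBounded_iff_forall_norm_le.mpr
      ⟨C, Set.forall_mem_range.mpr fun ν => hC ⟨ν, rfl⟩⟩
  · obtain ⟨U, hU, hvU⟩ := mapClusterPt_iff_ultrafilter.mp hvb
    exact le_of_tendsto_of_tendsto'
      (((htend hx).mono_left hU).add (hvU.inner (tendsto_const_nhds.sub (hx.mono_left hU))))
      ((htend tendsto_const_nhds).mono_left hU) fun ν => hv ν w
end
end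

section
/- Let g^ν, g : ℝⁿ → ℝ ∪ {+∞} be proper, lsc, convex functions with g^ν epi-converging to g. Suppose the set of minimizers argmin g is nonempty and let ρ ∈ (0, ∞) be such that argmin g ⊂ B(0, ρ/2), the closed Euclidean ball of radius ρ/2. If v^ν ∈ argmin g^ν for each ν, then v^ν ∈ B(0, ρ) for all but finitely many ν. -/
open Filter Topology
open scoped Classical

noncomputable section

lemma StrictMono.tendsto_extend_const {E : Type*} [TopologicalSpace E] {φ : ℕ → ℕ}
    (hφ : StrictMono φ) {w : ℕ → E} {a : E} (hw : Tendsto w atTop (𝓝 a)) :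
    Tendsto (Function.extend φ w fun _ => a) atTop (𝓝 a) := by
  intro U hU
  obtain ⟨K, hK⟩ := mem_atTop_sets.1 (hw hU)
  refine mem_map.2 (mem_atTop_sets.2 ⟨φ K, fun ν hν => ?_⟩)
  by_cases h : ∃ k, φ k = ν
  · obtain ⟨k, rfl⟩ := h
    simpa only [Set.mem_preimage, hφ.injective.extend_apply] using hK k (hφ.le_iff_le.1 hν)
  · simpa only [Set.mem_preimage, Function.extend_apply' _ _ _ h] using mem_of_mem_nhds hU

/-- A function with convex epigraph has convex strict sublevel sets. -/
lemma Convex.convex_lt_of_epiSet {E : Type*} [AddCommGroup E] [Module ℝ E] {f : E → EReal}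
    (hf : Convex ℝ (EpiSet f)) (c : EReal) : Convex ℝ {x | f x < c} := by
  intro x hx y hy a b ha hb hab
  obtain ⟨r, hr, hrc⟩ := EReal.lt_iff_exists_real_btwn.1 (max_lt hx hy)
  have hxr : (x, r) ∈ EpiSet f := (le_max_left _ _).trans hr.le
  have hyr : (y, r) ∈ EpiSet f := (le_max_right _ _).trans hr.le
  have h := hf hxr hyr ha hb hab
  have hr' : a • r + b • r = r := by rw [← add_smul, hab, one_smul]
  simp only [Prod.smul_mk, Prod.mk_add_mk, hr'] at h
  exact lt_of_le_of_lt h hrc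

lemma exists_mem_segment_norm_eq {E : Type*} [NormedAddCommGroup E] [NormedSpace ℝ E]
    {x y : E} {r : ℝ} (hx : ‖x‖ ≤ r) (hy : r ≤ ‖y‖) : ∃ w ∈ segment ℝ x y, ‖w‖ = r :=
  (convex_segment x y).isPreconnected.intermediate_value (left_mem_segment ℝ x y)
    (right_mem_segment ℝ x y) continuous_norm.continuousOn ⟨hx, hy⟩

/-- for epi-convergent proper lsc convex functions, minimizers of the
approximations eventually lie in a ball containing the minimizers of the limit. -/
theorem argmin_eventually_in_ball
    (n : ℕ)
    (g : EuclideanSpace ℝ (Fin n) → EReal) (gν : ℕ → EuclideanSpace ℝ (Fin n) → EReal)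
    (hbot : ∀ x, g x ≠ ⊥) (hνbot : ∀ ν x, gν ν x ≠ ⊥)
    (hproper : ∃ x, g x ≠ ⊤) (hνproper : ∀ ν, ∃ x, gν ν x ≠ ⊤)
    (hlsc : IsClosed (EpiSet g)) (hνlsc : ∀ ν, IsClosed (EpiSet (gν ν)))
    (hcvx : Convex ℝ (EpiSet g)) (hνcvx : ∀ ν, Convex ℝ (EpiSet (gν ν)))
    (hepi : EpiConverges gν g)
    (ρ : ℝ) (hρ : 0 < ρ)
    (hargne : {x : EuclideanSpace ℝ (Fin n) | ∀ y, g x ≤ g y}.Nonempty)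
    (hargsub : {x : EuclideanSpace ℝ (Fin n) | ∀ y, g x ≤ g y} ⊆
      Metric.closedBall 0 (ρ / 2))
    (v : ℕ → EuclideanSpace ℝ (Fin n)) (hv : ∀ ν, ∀ y, gν ν (v ν) ≤ gν ν y) :
    ∀ᶠ ν in atTop, v ν ∈ Metric.closedBall (0 : EuclideanSpace ℝ (Fin n)) ρ := by
  obtain ⟨x, hx⟩ := hargne
  obtain ⟨z, hz, hzlim⟩ := hepi.2 x
  have hxρ : ‖x‖ < ρ := by
    have := mem_closedBall_zero_iff.1 (hargsub hx)
    linarith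
  by_contra hbad
  have hfreq : ∃ᶠ ν in atTop, ∃ w ∈ Metric.sphere (0 : EuclideanSpace ℝ (Fin n)) ρ,
      ∀ c, gν ν (z ν) < c → gν ν w < c := by
    refine ((not_eventually.1 hbad).and_eventually (hz.norm.eventually_lt_const hxρ)).mono ?_
    rintro ν ⟨hvν, hzν⟩
    rw [mem_closedBall_zero_iff, not_le] at hvν
    obtain ⟨w, hw, hwρ⟩ := exists_mem_segment_norm_eq hzν.le hvν.le
    exact ⟨w, mem_sphere_zero_iff_norm.2 hwρ, fun c hc =>
      ((hνcvx ν).convex_lt_of_epiSet c).segment_subset hc ((hv ν _).trans_lt hc) hw⟩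
  obtain ⟨φ, hφ, hφw⟩ := extraction_of_frequently_atTop hfreq
  choose w hwρ hwlt using hφw
  obtain ⟨a, ha, ψ, hψ, hlim⟩ := (isCompact_sphere _ _).tendsto_subseq hwρ
  have hφψ : StrictMono (φ ∘ ψ) := hφ.comp hψ
  have hle : g a ≤ g x := by
    by_contra! hlt
    obtain ⟨c, hxc, hca⟩ := exists_between hlt
    have hlow := eventually_lt_of_lt_liminf
      (hca.trans_le (hepi.1 _ a (hφψ.tendsto_extend_const hlim)))
    have hup := eventually_lt_of_limsup_lt (hzlim.trans_lt hxc)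
    obtain ⟨k, hk₁, hk₂⟩ := (hφψ.tendsto_atTop.eventually (hlow.and hup)).exists
    rw [hφψ.injective.extend_apply] at hk₁
    exact lt_asymm hk₁ (hwlt (ψ k) c hk₂)
  have haρ := mem_closedBall_zero_iff.1 (hargsub fun y => hle.trans (hx y))
  rw [mem_sphere_zero_iff_norm.1 ha] at haρ
  linarith
end
end

section
/- (Consistency in the smooth case of Theorem 1.) Let X, X^ν ⊂ ℝⁿ be nonempty, closed, convex with X^ν set-converging to X; let h : ℝᵐ → ℝ be a (finite-valued) convex function, h^ν : ℝᵐ → ℝ ∪ {+∞} proper, lsc, convex with h^ν epi-converging to h; let f_i^ν, f_i : ℝⁿ → ℝ, i = 1, …, m, be continuously differentiable and such that whenever x^ν ∈ X^ν converges to x, one has f_i^ν(x^ν) → f_i(x) and ∇f_i^ν(x^ν) → ∇f_i(x) for each i. With F = (f_1, …, f_m), F^ν = (f_1^ν, …, f_m^ν), define φ(x) = h(F(x)) for x ∈ X, +∞ otherwise, and φ^ν(x) = h^ν(F^ν(x)) for x ∈ X^ν, +∞ otherwise; define the set-valued mappings S, S^ν : ℝⁿ×ℝᵐ×ℝᵐ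 ⇉ ℝᵐ×ℝᵐ×ℝⁿ by S(x,y,z) = {F(x) − z} × (∂h(z) − y) × (∇F(x)ᵀ y + N_X(x)) and S^ν(x,y,z) = {F^ν(x) − z} × (∂h^ν(z) − y) × (∇F^ν(x)ᵀ y + N_{X^ν}(x)). Then φ^ν epi-converges to φ and gph S^ν set-converges to gph S (graphical convergence), i.e., the pairs (φ^ν, S^ν) are consistent approximations of (φ, S). -/
open Filter Topology
open scoped Classical RealInnerProductSpace

noncomputable section

/-- The subdifferential of a real-valued convex function on ℝ^m. -/
def SubdiffR {m : ℕ} (g : (Fin m → ℝ) → ℝ) (z : Fin m → ℝ) : Set (Fin m → ℝ) :=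
  {v | ∀ w, g z + ∑ i, v i * (w i - z i) ≤ g w}

/-- The subdifferential of an extended-real-valued convex function on ℝ^m. -/
def SubdiffE {m : ℕ} (g : (Fin m → ℝ) → EReal) (z : Fin m → ℝ) : Set (Fin m → ℝ) :=
  {v | ∀ w, g z + ((∑ i, v i * (w i - z i) : ℝ) : EReal) ≤ g w}

/-- The normal cone of a convex set, empty outside the set. -/
def NormalCone {n : ℕ} (C : Set (EuclideanSpace ℝ (Fin n))) (x : EuclideanSpace ℝ (Fin n)) :
    Set (EuclideanSpace ℝ (Fin n)) :=
  {w | x ∈ C ∧ ∀ x' ∈ C, ⟪w, x' - x⟫ ≤ 0}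

/-- The graph of the optimality-condition mapping
S(x,y,z) = {F(x) − z} × (∂h(z) − y) × (∇F(x)ᵀ y + N_X(x)). -/
def GphS {n m : ℕ} (F : EuclideanSpace ℝ (Fin n) → Fin m → ℝ)
    (gradF : EuclideanSpace ℝ (Fin n) → Fin m → EuclideanSpace ℝ (Fin n))
    (subh : (Fin m → ℝ) → Set (Fin m → ℝ)) (X : Set (EuclideanSpace ℝ (Fin n))) :
    Set ((EuclideanSpace ℝ (Fin n) × (Fin m → ℝ) × (Fin m → ℝ)) ×
      ((Fin m → ℝ) × (Fin m → ℝ) × EuclideanSpace ℝ (Fin n))) :=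
  {q | q.2.1 = F q.1.1 - q.1.2.2 ∧
       q.2.2.1 + q.1.2.1 ∈ subh q.1.2.2 ∧
       q.2.2.2 - ∑ i, q.1.2.1 i • gradF q.1.1 i ∈ NormalCone X q.1.1}

/-- A sequence prescribed along a subsequence, with its remaining terms taken from another sequence
with the same limit. -/
theorem tendsto_extend_of_strictMono {E : Type*} [TopologicalSpace E] {N : ℕ → ℕ}
    (hN : StrictMono N) {x e : ℕ → E} {x0 : E} (hx : Tendsto x atTop (𝓝 x0))
    (he : Tendsto e atTop (𝓝 x0)) : Tendsto (Function.extend N x e) atTop (𝓝 x0) := by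
  intro U hU
  obtain ⟨K, hK⟩ := eventually_atTop.1 (show ∀ᶠ k in atTop, x k ∈ U from hx hU)
  obtain ⟨M, hM⟩ := eventually_atTop.1 (show ∀ᶠ k in atTop, e k ∈ U from he hU)
  refine mem_map.2 (mem_atTop_sets.2 ⟨max (N K) M, fun ν hν => ?_⟩)
  by_cases hk : ∃ k, N k = ν
  · obtain ⟨k, rfl⟩ := hk
    simpa [hN.injective.extend_apply] using
      hK k (hN.le_iff_le.1 ((le_max_left _ _).trans hν))
  · simpa [Function.extend_apply' _ _ _ hk] using hM ν ((le_max_right _ _).trans hν)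

/-- If points of `C ν` converging to `x0` have images under `g ν` converging to `l`, then this also
holds along subsequences. -/
theorem tendsto_subseq_of_tendsto_extend {E G : Type*} [TopologicalSpace E] [TopologicalSpace G]
    {C : ℕ → Set E} {g : ℕ → E → G} {x0 : E} {l : G}
    (hg : ∀ x : ℕ → E, (∀ ν, x ν ∈ C ν) → Tendsto x atTop (𝓝 x0) →
      Tendsto (fun ν => g ν (x ν)) atTop (𝓝 l))
    {e : ℕ → E} (heC : ∀ ν, e ν ∈ C ν) (he : Tendsto e atTop (𝓝 x0))
    {N : ℕ → ℕ} (hN : StrictMono N) {x : ℕ → E} (hxC : ∀ k, x k ∈ C (N k))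
    (hx : Tendsto x atTop (𝓝 x0)) : Tendsto (fun k => g (N k) (x k)) atTop (𝓝 l) := by
  have key := (hg (Function.extend N x e) (fun ν => ?_)
    (tendsto_extend_of_strictMono hN hx he)).comp hN.tendsto_atTop
  · simpa [Function.comp_def, hN.injective.extend_apply] using key
  · by_cases hk : ∃ k, N k = ν
    · obtain ⟨k, rfl⟩ := hk
      simpa [hN.injective.extend_apply] using hxC k
    · simpa [Function.extend_apply' _ _ _ hk] using heC ν

/-- Coordinate perturbations of size `δ` cannot move all the points `±r eⱼ` to one side of a
hyperplane through a point `δ`-close to the origin. -/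
theorem exists_le_apply_cross_polytope {m : ℕ} [Nonempty (Fin m)] {r δ : ℝ} (hδ : m * (2 * δ) ≤ r)
    (φ : (Fin m → ℝ) →ₗ[ℝ] ℝ) {y0 y : Fin m → ℝ} (hy : ∀ i, |y i - y0 i| ≤ δ)
    {p q : Fin m → Fin m → ℝ} (hp : ∀ j i, |p j i - (y0 + Pi.single j r : Fin m → ℝ) i| ≤ δ)
    (hq : ∀ j i, |q j i - (y0 + Pi.single j (-r) : Fin m → ℝ) i| ≤ δ) :
    ∃ j, φ y ≤ φ (p j) ∨ φ y ≤ φ (q j) := by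
  set a : Fin m → ℝ := fun i => φ (Pi.single i 1) with ha
  have hφ : ∀ v, φ v = ∑ i, v i * a i := fun v => by
    conv_lhs => rw [pi_eq_sum_univ' v]
    simp [ha]
  obtain ⟨j, hj⟩ := Finite.exists_max (fun i => |a i|)
  have hδ0 : 0 ≤ δ := (abs_nonneg _).trans (hy j)
  have bound : ∀ (s : ℝ) (w : Fin m → ℝ),
      (∀ i, |w i - (y0 + Pi.single j s : Fin m → ℝ) i| ≤ δ) →
        s * a j ≤ φ w - φ y + r * |a j| := by
    intro s w hw
    have hs : s * a j = φ (Pi.single j s) := by simp [hφ, Pi.single_apply]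
    have hsplit : φ w - φ y = s * a j - φ (y - y0 - (w - (y0 + Pi.single j s))) := by
      rw [hs]; simp only [map_sub, map_add]; ring
    have herr : φ (y - y0 - (w - (y0 + Pi.single j s))) ≤ ∑ _i : Fin m, (2 * δ) * |a j| := by
      rw [hφ]
      refine Finset.sum_le_sum fun i _ => (le_abs_self _).trans ?_
      rw [abs_mul]
      refine mul_le_mul ?_ (hj i) (abs_nonneg _) (by positivity)
      have := abs_sub (y i - y0 i) (w i - (y0 + Pi.single j s : Fin m → ℝ) i)
      exact this.trans (by linarith [hw i, hy i])
    have : ∑ _i : Fin m, (2 * δ) * |a j| ≤ r * |a j| := by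
      simp only [Finset.sum_const, Finset.card_univ, Fintype.card_fin, nsmul_eq_mul]
      rw [← mul_assoc]
      exact mul_le_mul_of_nonneg_right hδ (abs_nonneg _)
    linarith
  refine ⟨j, ?_⟩
  rcases le_total 0 (a j) with h0 | h0
  · left
    have := bound r (p j) (hp j)
    rw [abs_of_nonneg h0] at this
    linarith
  · right
    have := bound (-r) (q j) (hq j)
    rw [abs_of_nonpos h0] at this
    linarith

theorem convex_setOf_le_of_convex_epiSet {m : ℕ} {g : (Fin m → ℝ) → EReal}
    (hg : Convex ℝ (EpiSet g)) (c : ℝ) : Convex ℝ {w | g w ≤ c} := by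
  intro x hx y hy a b ha hb hab
  have := hg (x := (x, c)) hx (y := (y, c)) hy ha hb hab
  have hc : a * c + b * c = c := by rw [← add_mul, hab, one_mul]
  simpa [EpiSet, hc, -EReal.coe_add, -EReal.coe_mul] using this

theorem isClosed_setOf_le_of_isClosed_epiSet {m : ℕ} {g : (Fin m → ℝ) → EReal}
    (hg : IsClosed (EpiSet g)) (c : ℝ) : IsClosed {w | g w ≤ c} :=
  hg.preimage (f := fun w : Fin m → ℝ => (w, c)) (by fun_prop)

/-- Epi-convergence of convex functions to a finite-valued one is continuous convergence. -/
theorem EpiConverges.tendsto_of_convex {m : ℕ} {h : (Fin m → ℝ) → ℝ}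
    (hcvx : ConvexOn ℝ Set.univ h) {hν : ℕ → (Fin m → ℝ) → EReal}
    (hνlsc : ∀ ν, IsClosed (EpiSet (hν ν))) (hνcvx : ∀ ν, Convex ℝ (EpiSet (hν ν)))
    (hepi : EpiConverges hν (fun z => ((h z : ℝ) : EReal)))
    {y : ℕ → Fin m → ℝ} {y0 : Fin m → ℝ} (hy : Tendsto y atTop (𝓝 y0)) :
    Tendsto (fun ν => hν ν (y ν)) atTop (𝓝 ((h y0 : ℝ) : EReal)) := by
  refine tendsto_order.2 ⟨fun b hb =>
    eventually_lt_of_lt_liminf (hb.trans_le (hepi.1 y y0 hy)), fun b hb => ?_⟩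
  obtain ⟨c, hc, hcb⟩ := EReal.lt_iff_exists_real_btwn.1 hb
  rw [EReal.coe_lt_coe_iff] at hc
  suffices ∀ᶠ ν in atTop, hν ν (y ν) ≤ c from this.mono fun ν hle => hle.trans_lt hcb
  have hcont : Continuous h := continuousOn_univ.1 (hcvx.continuousOn isOpen_univ)
  choose P hP hPsup using hepi.2
  have hPc : ∀ p, h p < c → ∀ᶠ ν in atTop, hν ν (P p ν) < c := fun p hp =>
    eventually_lt_of_limsup_lt ((hPsup p).trans_lt (EReal.coe_lt_coe_iff.2 hp))
  rcases isEmpty_or_nonempty (Fin m) with hm | hm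
  · filter_upwards [hPc y0 hc] with ν hlt
    rw [Subsingleton.elim (y ν) (P y0 ν)]
    exact hlt.le
  obtain ⟨r, hr, hball⟩ : ∃ r > 0, ∀ p, dist p y0 ≤ r → h p < c := by
    obtain ⟨r, hr, hs⟩ := Metric.nhds_basis_closedBall.eventually_iff.1
      (hcont.continuousAt.eventually (gt_mem_nhds hc))
    exact ⟨r, hr, fun p hp => hs hp⟩
  have hm0 : (0 : ℝ) < m := by
    have : 0 < m := Fin.pos_iff_nonempty.2 hm
    exact_mod_cast this
  set δ : ℝ := r / (2 * m) with hδ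
  have hδ0 : 0 < δ := by positivity
  have hclose : ∀ {x : ℕ → Fin m → ℝ} {x0}, Tendsto x atTop (𝓝 x0) →
      ∀ᶠ ν in atTop, ∀ i, |x ν i - x0 i| ≤ δ := fun {x x0} hx => by
    filter_upwards [hx.eventually (Metric.closedBall_mem_nhds x0 hδ0)] with ν hd i
    exact (dist_le_pi_dist (x ν) x0 i).trans hd
  have hpt : ∀ j s, |s| = r → h (y0 + Pi.single j s) < c := fun j s hs => hball _ <| by
    rw [dist_eq_norm, add_sub_cancel_left, Pi.norm_single, Real.norm_eq_abs, hs]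
  have hr1 : |r| = r := abs_of_pos hr
  have hr2 : |(-r)| = r := by rw [abs_neg, hr1]
  have hval : ∀ s, |s| = r →
      ∀ᶠ ν in atTop, ∀ j, hν ν (P (y0 + Pi.single j s) ν) < c := fun s hs =>
    eventually_all.2 fun j => hPc _ (hpt j s hs)
  have hcoord : ∀ s : ℝ, ∀ᶠ ν in atTop, ∀ j i,
      |P (y0 + Pi.single j s) ν i - (y0 + Pi.single j s : Fin m → ℝ) i| ≤ δ := fun s =>
    eventually_all.2 fun j => hclose (hP (y0 + Pi.single j s))
  filter_upwards [hclose hy, hval r hr1, hval (-r) hr2, hcoord r, hcoord (-r)]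
    with ν h1 h2 h3 h4 h5
  by_contra hnot
  obtain ⟨φ, u, hφ, hu⟩ := geometric_hahn_banach_closed_point
    (convex_setOf_le_of_convex_epiSet (hνcvx ν) c)
    (isClosed_setOf_le_of_isClosed_epiSet (hνlsc ν) c) (x := y ν) hnot
  obtain ⟨j, hj⟩ := exists_le_apply_cross_polytope (r := r) (δ := δ) (by rw [hδ]; field_simp; exact le_rfl)
    φ.toLinearMap h1 h4 h5
  rcases hj with hj | hj
  · exact absurd ((hφ _ (h2 j).le).trans hu) (not_lt.2 hj)
  · exact absurd ((hφ _ (h3 j).le).trans hu) (not_lt.2 hj)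

theorem EpiConverges.tendsto_subseq_of_convex {m : ℕ} {h : (Fin m → ℝ) → ℝ}
    (hcvx : ConvexOn ℝ Set.univ h) {hν : ℕ → (Fin m → ℝ) → EReal}
    (hνlsc : ∀ ν, IsClosed (EpiSet (hν ν))) (hνcvx : ∀ ν, Convex ℝ (EpiSet (hν ν)))
    (hepi : EpiConverges hν (fun z => ((h z : ℝ) : EReal))) {N : ℕ → ℕ} (hN : StrictMono N)
    {y : ℕ → Fin m → ℝ} {y0 : Fin m → ℝ} (hy : Tendsto y atTop (𝓝 y0)) :
    Tendsto (fun k => hν (N k) (y k)) atTop (𝓝 ((h y0 : ℝ) : EReal)) :=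
  tendsto_subseq_of_tendsto_extend (C := fun _ => Set.univ) (g := hν)
    (fun _ _ hx => hepi.tendsto_of_convex hcvx hνlsc hνcvx hx) (fun _ => Set.mem_univ _)
    (tendsto_const_nhds (x := y0)) hN (fun _ => Set.mem_univ _) hy

/-- Normal vectors to a limit of closed convex sets are limits of normal vectors. -/
theorem SetConverges.exists_tendsto_normal {E : Type*} [NormedAddCommGroup E]
    [InnerProductSpace ℝ E] [ProperSpace E] {C : ℕ → Set E} {C0 : Set E}
    (hC : SetConverges C C0) (hne : ∀ ν, (C ν).Nonempty) (hcl : ∀ ν, IsClosed (C ν))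
    (hcv : ∀ ν, Convex ℝ (C ν)) {x0 w0 : E} (hx0 : x0 ∈ C0)
    (hw0 : ∀ x' ∈ C0, ⟪w0, x' - x0⟫ ≤ 0) :
    ∃ x w : ℕ → E, (∀ ν, x ν ∈ C ν ∧ ∀ x' ∈ C ν, ⟪w ν, x' - x ν⟫ ≤ 0) ∧
      Tendsto x atTop (𝓝 x0) ∧ Tendsto w atTop (𝓝 w0) := by
  have hproj : ∀ ν, ∃ v ∈ C ν, ∀ x' ∈ C ν, ⟪x0 + w0 - v, x' - v⟫ ≤ 0 := fun ν => by
    obtain ⟨v, hv, hmin⟩ := exists_norm_eq_iInf_of_complete_convex (hne ν) (hcl ν).isComplete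
      (hcv ν) (x0 + w0)
    exact ⟨v, hv, (norm_eq_iInf_iff_real_inner_le_zero (hcv ν) hv).1 hmin⟩
  choose x hxC hx using hproj
  suffices hlim : Tendsto x atTop (𝓝 x0) from
    ⟨x, fun ν => x0 + w0 - x ν, fun ν => ⟨hxC ν, hx ν⟩, hlim, by
      simpa using (tendsto_const_nhds (x := x0 + w0)).sub hlim⟩
  obtain ⟨e, heC, he⟩ := hC.2 x0 hx0
  have hbound : ∀ ν, ‖e ν - x ν‖ ≤ ‖x0 + w0 - e ν‖ := fun ν => by
    have h1 : ⟪e ν - x ν, e ν - x ν⟫ ≤ -⟪x0 + w0 - e ν, e ν - x ν⟫ := by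
      have := hx ν (e ν) (heC ν)
      rw [← sub_add_sub_cancel (x0 + w0) (e ν) (x ν), inner_add_left] at this
      linarith
    have h2 := (neg_le_abs _).trans (abs_real_inner_le_norm (x0 + w0 - e ν) (e ν - x ν))
    rw [real_inner_self_eq_norm_mul_norm] at h1
    by_contra! hlt
    nlinarith [norm_nonneg (x0 + w0 - e ν)]
  obtain ⟨R, hR⟩ := ((tendsto_const_nhds (x := x0 + w0)).sub he).norm.bddAbove_range
  obtain ⟨R', hR'⟩ := he.norm.bddAbove_range
  have hxb : ∀ ν, x ν ∈ Metric.closedBall (0 : E) (R' + R) := fun ν => by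
    rw [mem_closedBall_zero_iff]
    have h1 : ‖x ν‖ ≤ ‖e ν‖ + ‖e ν - x ν‖ := norm_le_norm_add_norm_sub _ _
    have h2 : ‖x0 + w0 - e ν‖ ≤ R := hR ⟨ν, rfl⟩
    have h3 : ‖e ν‖ ≤ R' := hR' ⟨ν, rfl⟩
    linarith [hbound ν]
  refine tendsto_of_subseq_tendsto fun ns hns => ?_
  obtain ⟨a, -, φ, hφ, ha⟩ := tendsto_subseq_of_bounded Metric.isBounded_closedBall
    (x := x ∘ ns) fun k => hxb (ns k)
  obtain ⟨ψ, hψ, hmono⟩ := strictMono_subseq_of_tendsto_atTop (hns.comp hφ.tendsto_atTop)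
  refine ⟨φ ∘ ψ, ?_⟩
  have ha' : Tendsto (fun k => x (ns (φ (ψ k)))) atTop (𝓝 a) := ha.comp hψ.tendsto_atTop
  have haC : a ∈ C0 := hC.1 (ns ∘ φ ∘ ψ) _ a hmono (fun k => hxC _) ha'
  have he' : Tendsto (fun k => e (ns (φ (ψ k)))) atTop (𝓝 x0) := he.comp hmono.tendsto_atTop
  have hle : ⟪x0 + w0 - a, x0 - a⟫ ≤ 0 :=
    le_of_tendsto ((tendsto_const_nhds.sub ha').inner (he'.sub ha'))
      (Eventually.of_forall fun k => hx _ _ (heC _))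
  have hsum : ⟪x0 - a, x0 - a⟫ ≤ 0 := by
    have := hw0 a haC
    rw [← neg_sub, inner_neg_right] at this
    rw [add_sub_right_comm, inner_add_left] at hle
    linarith
  have : x0 - a = 0 := by
    rw [← inner_self_eq_zero (𝕜 := ℝ)]
    exact le_antisymm hsum real_inner_self_nonneg
  rw [sub_eq_zero.1 this]
  exact ha'

/-- The epigraph as a subset of a Euclidean space. -/
def EuclideanEpi {m : ℕ} (g : (Fin m → ℝ) → EReal) :
    Set (WithLp 2 (EuclideanSpace ℝ (Fin m) × ℝ)) :=
  {p | g p.fst ≤ p.snd}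

theorem isClosed_euclideanEpi {m : ℕ} {g : (Fin m → ℝ) → EReal} (hg : IsClosed (EpiSet g)) :
    IsClosed (EuclideanEpi g) :=
  hg.preimage (f := fun p : WithLp 2 (EuclideanSpace ℝ (Fin m) × ℝ) =>
    ((p.fst : Fin m → ℝ), p.snd)) (by fun_prop)

theorem convex_euclideanEpi {m : ℕ} {g : (Fin m → ℝ) → EReal} (hg : Convex ℝ (EpiSet g)) :
    Convex ℝ (EuclideanEpi g) := by
  intro x hx y hy a b ha hb hab
  exact hg (x := ((x.fst : Fin m → ℝ), x.snd)) hx (y := ((y.fst : Fin m → ℝ), y.snd)) hy ha hb hab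

theorem inner_toLp_prod {m : ℕ} (p q : WithLp 2 (EuclideanSpace ℝ (Fin m) × ℝ)) :
    ⟪p, q⟫ = ∑ i, p.fst i * q.fst i + p.snd * q.snd := by
  simp [WithLp.prod_inner_apply, PiLp.inner_apply, mul_comm]

/-- A non-horizontal normal to the epigraph gives a subgradient. -/
theorem smul_mem_subdiffE_of_normal {m : ℕ} {g : (Fin m → ℝ) → EReal} (hbot : ∀ z, g z ≠ ⊥)
    {p w : WithLp 2 (EuclideanSpace ℝ (Fin m) × ℝ)} (hp : p ∈ EuclideanEpi g)
    (hw : ∀ p' ∈ EuclideanEpi g, ⟪w, p' - p⟫ ≤ 0) (hneg : w.snd < 0) :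
    ((-w.snd)⁻¹ • w.fst : EuclideanSpace ℝ (Fin m)).ofLp ∈ SubdiffE g p.fst := by
  intro z
  induction hz : g z with
  | bot => exact absurd hz (hbot z)
  | top => exact le_top
  | coe α =>
    have hn := hw (WithLp.toLp 2 (WithLp.toLp 2 z, α)) (by simp [EuclideanEpi, hz])
    rw [inner_toLp_prod] at hn
    change ∑ i, w.fst i * (z i - p.fst i) + w.snd * (α - p.snd) ≤ 0 at hn
    refine (add_le_add_left hp _).trans ?_
    rw [← EReal.coe_add, EReal.coe_le_coe_iff]
    simp only [PiLp.smul_apply, smul_eq_mul, mul_assoc, ← Finset.mul_sum]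
    have hpos : 0 < -w.snd := by linarith
    have : (-w.snd)⁻¹ * ∑ i, w.fst i * (z i - p.fst i) ≤ α - p.snd := by
      rw [inv_mul_le_iff₀ hpos]
      linarith
    linarith

/-- A proper lsc convex function is subdifferentiable somewhere. -/
theorem exists_mem_subdiffE {m : ℕ} {g : (Fin m → ℝ) → EReal} (hbot : ∀ z, g z ≠ ⊥)
    (hproper : ∃ z, g z ≠ ⊤) (hcl : IsClosed (EpiSet g)) (hcv : Convex ℝ (EpiSet g)) :
    ∃ z v, v ∈ SubdiffE g z := by
  obtain ⟨z, hz⟩ := hproper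
  lift g z to ℝ using ⟨hz, hbot z⟩ with α hα
  set q : WithLp 2 (EuclideanSpace ℝ (Fin m) × ℝ) := WithLp.toLp 2 (WithLp.toLp 2 z, α) with hq
  set q' : WithLp 2 (EuclideanSpace ℝ (Fin m) × ℝ) := WithLp.toLp 2 (WithLp.toLp 2 z, α - 1)
    with hq'
  have hqm : q ∈ EuclideanEpi g := by simp [EuclideanEpi, hq, ← hα]
  obtain ⟨p, hp, hmin⟩ := exists_norm_eq_iInf_of_complete_convex ⟨q, hqm⟩
    (isClosed_euclideanEpi hcl).isComplete (convex_euclideanEpi hcv) q'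
  have hn := (norm_eq_iInf_iff_real_inner_le_zero (convex_euclideanEpi hcv) hp).1 hmin
  refine ⟨_, _, smul_mem_subdiffE_of_normal hbot hp hn ?_⟩
  have h1 := hn q hqm
  rw [inner_toLp_prod] at h1
  have hsq : ∑ i, (q' - p).fst i * (q - p).fst i = ∑ i, (z i - p.fst i) ^ 2 := by
    refine Finset.sum_congr rfl fun i _ => ?_
    simp [hq, hq', sq]
  have hs1 : (q' - p).snd = α - 1 - p.snd := rfl
  have hs2 : (q - p).snd = α - p.snd := rfl
  rw [hsq, hs1, hs2] at h1
  rw [hs1]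
  by_contra! hge
  have hs0 : 0 ≤ ∑ i, (z i - p.fst i) ^ 2 := Finset.sum_nonneg fun i _ => sq_nonneg _
  have hsum : ∑ i, (z i - p.fst i) ^ 2 = 0 := by nlinarith
  have hpz : p.fst.ofLp = z := funext fun i => by
    have := (Finset.sum_eq_zero_iff_of_nonneg fun i _ => sq_nonneg (z i - p.fst i)).1 hsum i
      (Finset.mem_univ i)
    linarith [pow_eq_zero_iff (two_ne_zero) |>.1 this]
  have hle : g p.fst ≤ p.snd := hp
  rw [hpz, ← hα, EReal.coe_le_coe_iff] at hle
  linarith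

/-- Epi-convergence of convex functions to a finite-valued one is convergence of epigraphs. -/
theorem EpiConverges.setConverges_euclideanEpi {m : ℕ} {h : (Fin m → ℝ) → ℝ}
    (hcvx : ConvexOn ℝ Set.univ h) {hν : ℕ → (Fin m → ℝ) → EReal}
    (hνbot : ∀ ν z, hν ν z ≠ ⊥) (hνproper : ∀ ν, ∃ z, hν ν z ≠ ⊤)
    (hνlsc : ∀ ν, IsClosed (EpiSet (hν ν))) (hνcvx : ∀ ν, Convex ℝ (EpiSet (hν ν)))
    (hepi : EpiConverges hν (fun z => ((h z : ℝ) : EReal))) :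
    SetConverges (fun ν => EuclideanEpi (hν ν)) (EuclideanEpi fun z => ((h z : ℝ) : EReal)) := by
  constructor
  · intro N x x0 hN hx hlim
    have hfst : Tendsto (fun k => (x k).fst.ofLp) atTop (𝓝 x0.fst.ofLp) :=
      ((by fun_prop : Continuous fun p : WithLp 2 (EuclideanSpace ℝ (Fin m) × ℝ) =>
        p.fst.ofLp).tendsto x0).comp hlim
    have hsnd : Tendsto (fun k => (x k).snd) atTop (𝓝 x0.snd) :=
      ((by fun_prop : Continuous fun p : WithLp 2 (EuclideanSpace ℝ (Fin m) × ℝ) =>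
        p.snd).tendsto x0).comp hlim
    exact le_of_tendsto_of_tendsto'
      (hepi.tendsto_subseq_of_convex hcvx hνlsc hνcvx hN hfst)
      ((continuous_coe_real_ereal.tendsto _).comp hsnd) hx
  · intro p hp
    have hp' : h p.fst ≤ p.snd := EReal.coe_le_coe_iff.1 hp
    have hlim := hepi.tendsto_of_convex hcvx hνlsc hνcvx
      (tendsto_const_nhds (x := p.fst.ofLp) (f := atTop))
    have hmax : Tendsto (fun ν => max p.snd (hν ν p.fst).toReal) atTop (𝓝 p.snd) := by
      have := (tendsto_const_nhds (x := p.snd)).max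
        ((EReal.tendsto_toReal (EReal.coe_ne_top _) (EReal.coe_ne_bot _)).comp hlim)
      simpa [max_eq_left hp', Function.comp_def] using this
    choose z hz using hνproper
    refine ⟨fun ν => if hν ν p.fst = ⊤
      then WithLp.toLp 2 (WithLp.toLp 2 (z ν), (hν ν (z ν)).toReal)
      else WithLp.toLp 2 (p.fst, max p.snd (hν ν p.fst).toReal), fun ν => ?_, ?_⟩
    · simp only []
      split_ifs with htop
      · exact (EReal.coe_toReal (hz ν) (hνbot ν _)).ge
      · exact (EReal.coe_toReal htop (hνbot ν _)).ge.trans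
          (EReal.coe_le_coe_iff.2 (le_max_right _ _))
    · have hpair : Tendsto (fun ν => (WithLp.toLp 2 (p.fst, max p.snd (hν ν p.fst).toReal) :
          WithLp 2 (EuclideanSpace ℝ (Fin m) × ℝ))) atTop (𝓝 p) :=
        ((by fun_prop : Continuous fun t : ℝ => (WithLp.toLp 2 (p.fst, t) :
          WithLp 2 (EuclideanSpace ℝ (Fin m) × ℝ))).tendsto p.snd).comp hmax
      refine hpair.congr' ?_
      filter_upwards [hlim.eventually_lt_const (EReal.coe_lt_top _)] with ν hlt
      rw [if_neg hlt.ne]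

/-- Subgradients of a finite epi-limit of convex functions are limits of subgradients. -/
theorem EpiConverges.exists_tendsto_subdiffE {m : ℕ} {h : (Fin m → ℝ) → ℝ}
    (hcvx : ConvexOn ℝ Set.univ h) {hν : ℕ → (Fin m → ℝ) → EReal}
    (hνbot : ∀ ν z, hν ν z ≠ ⊥) (hνproper : ∀ ν, ∃ z, hν ν z ≠ ⊤)
    (hνlsc : ∀ ν, IsClosed (EpiSet (hν ν))) (hνcvx : ∀ ν, Convex ℝ (EpiSet (hν ν)))
    (hepi : EpiConverges hν (fun z => ((h z : ℝ) : EReal)))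
    {z0 v0 : Fin m → ℝ} (hv0 : v0 ∈ SubdiffR h z0) :
    ∃ z v : ℕ → Fin m → ℝ, (∀ ν, v ν ∈ SubdiffE (hν ν) (z ν)) ∧
      Tendsto z atTop (𝓝 z0) ∧ Tendsto v atTop (𝓝 v0) := by
  have hC := hepi.setConverges_euclideanEpi hcvx hνbot hνproper hνlsc hνcvx
  have hne : ∀ ν, (EuclideanEpi (hν ν)).Nonempty := fun ν => by
    obtain ⟨z, hz⟩ := hνproper ν
    exact ⟨WithLp.toLp 2 (WithLp.toLp 2 z, (hν ν z).toReal),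
      (EReal.coe_toReal hz (hνbot ν _)).ge⟩
  obtain ⟨p, w, hpw, hp, hw⟩ := hC.exists_tendsto_normal hne
    (fun ν => isClosed_euclideanEpi (hνlsc ν)) (fun ν => convex_euclideanEpi (hνcvx ν))
    (x0 := WithLp.toLp 2 (WithLp.toLp 2 z0, h z0)) (w0 := WithLp.toLp 2 (WithLp.toLp 2 v0, -1))
    (le_refl ((h z0 : ℝ) : EReal)) (fun p' hp' => by
      have h1 : h p'.fst ≤ p'.snd := EReal.coe_le_coe_iff.1 hp'
      have h2 := hv0 p'.fst
      rw [inner_toLp_prod]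
      change ∑ i, v0 i * (p'.fst i - z0 i) + -1 * (p'.snd - h z0) ≤ 0
      linarith)
  have hfst : Continuous fun p : WithLp 2 (EuclideanSpace ℝ (Fin m) × ℝ) => p.fst.ofLp := by
    fun_prop
  have hpz : Tendsto (fun ν => (p ν).fst.ofLp) atTop (𝓝 z0) := (hfst.tendsto _).comp hp
  have hwv : Tendsto (fun ν => (w ν).fst.ofLp) atTop (𝓝 v0) := (hfst.tendsto _).comp hw
  have hws : Tendsto (fun ν => (w ν).snd) atTop (𝓝 (-1)) :=
    ((by fun_prop : Continuous fun p : WithLp 2 (EuclideanSpace ℝ (Fin m) × ℝ) =>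
      p.snd).tendsto _).comp hw
  choose z' v' hv' using fun ν => exists_mem_subdiffE (hνbot ν) (hνproper ν) (hνlsc ν) (hνcvx ν)
  have hev : ∀ᶠ ν in atTop, (w ν).snd < 0 := hws.eventually_lt_const (by norm_num)
  refine ⟨fun ν => if (w ν).snd < 0 then (p ν).fst.ofLp else z' ν,
    fun ν => if (w ν).snd < 0 then (-(w ν).snd)⁻¹ • (w ν).fst.ofLp else v' ν, fun ν => ?_, ?_, ?_⟩
  · by_cases hneg : (w ν).snd < 0
    · simpa only [if_pos hneg, WithLp.ofLp_smul] using
        smul_mem_subdiffE_of_normal (hνbot ν) (hpw ν).1 (hpw ν).2 hneg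
    · simpa only [if_neg hneg] using hv' ν
  · exact hpz.congr' (hev.mono fun ν hneg => (if_pos hneg).symm)
  · have hlim : Tendsto (fun ν => (-(w ν).snd)⁻¹ • (w ν).fst.ofLp) atTop (𝓝 v0) := by
      simpa using (hws.neg.inv₀ (by norm_num)).smul hwv
    exact hlim.congr' (hev.mono fun ν hneg => (if_pos hneg).symm)

/-- Limits of subgradients along a subsequence are subgradients of the epi-limit. -/
theorem EpiConverges.mem_subdiffR_of_tendsto {m : ℕ} {h : (Fin m → ℝ) → ℝ}
    (hcvx : ConvexOn ℝ Set.univ h) {hν : ℕ → (Fin m → ℝ) → EReal}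
    (hνlsc : ∀ ν, IsClosed (EpiSet (hν ν))) (hνcvx : ∀ ν, Convex ℝ (EpiSet (hν ν)))
    (hepi : EpiConverges hν (fun z => ((h z : ℝ) : EReal)))
    {N : ℕ → ℕ} (hN : StrictMono N) {z v : ℕ → Fin m → ℝ} {z0 v0 : Fin m → ℝ}
    (hmem : ∀ k, v k ∈ SubdiffE (hν (N k)) (z k))
    (hz : Tendsto z atTop (𝓝 z0)) (hv : Tendsto v atTop (𝓝 v0)) : v0 ∈ SubdiffR h z0 := by
  intro w
  have hsum : Tendsto (fun k => ∑ i, v k i * (w i - z k i)) atTop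
      (𝓝 (∑ i, v0 i * (w i - z0 i))) :=
    tendsto_finsetSum _ fun i _ =>
      (tendsto_pi_nhds.1 hv i).mul (tendsto_const_nhds.sub (tendsto_pi_nhds.1 hz i))
  have hle := le_of_tendsto_of_tendsto'
    ((EReal.continuousAt_add (p := ((h z0 : EReal), ((∑ i, v0 i * (w i - z0 i) : ℝ) : EReal)))
      (.inl (EReal.coe_ne_top _)) (.inl (EReal.coe_ne_bot _))).tendsto.comp
      ((hepi.tendsto_subseq_of_convex hcvx hνlsc hνcvx hN hz).prodMk_nhds
        ((continuous_coe_real_ereal.tendsto _).comp hsum)))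
    (hepi.tendsto_subseq_of_convex hcvx hνlsc hνcvx hN tendsto_const_nhds)
    (fun k => hmem k w)
  simpa only [← EReal.coe_add, EReal.coe_le_coe_iff] using hle

/-- Limits of normal vectors along a subsequence are normal to the limit set. -/
theorem SetConverges.mem_normalCone_of_tendsto {n : ℕ} {C : ℕ → Set (EuclideanSpace ℝ (Fin n))}
    {C0 : Set (EuclideanSpace ℝ (Fin n))} (hC : SetConverges C C0) {N : ℕ → ℕ}
    (hN : StrictMono N) {x w : ℕ → EuclideanSpace ℝ (Fin n)} {x0 w0 : EuclideanSpace ℝ (Fin n)}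
    (hmem : ∀ k, w k ∈ NormalCone (C (N k)) (x k))
    (hx : Tendsto x atTop (𝓝 x0)) (hw : Tendsto w atTop (𝓝 w0)) : w0 ∈ NormalCone C0 x0 := by
  refine ⟨hC.1 N x x0 hN (fun k => (hmem k).1) hx, fun x' hx' => ?_⟩
  obtain ⟨e, heC, he⟩ := hC.2 x' hx'
  exact le_of_tendsto' (hw.inner ((he.comp hN.tendsto_atTop).sub hx))
    fun k => (hmem k).2 _ (heC _)

/-- Epi-convergence of composite functions restricted to converging sets. -/
theorem EpiConverges.comp_restrict {E : Type*} [TopologicalSpace E] {m : ℕ} {C : ℕ → Set E}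
    {C0 : Set E} (hC : SetConverges C C0) {h : (Fin m → ℝ) → ℝ}
    (hcvx : ConvexOn ℝ Set.univ h) {hν : ℕ → (Fin m → ℝ) → EReal}
    (hνlsc : ∀ ν, IsClosed (EpiSet (hν ν))) (hνcvx : ∀ ν, Convex ℝ (EpiSet (hν ν)))
    (hepi : EpiConverges hν (fun z => ((h z : ℝ) : EReal)))
    {F : E → Fin m → ℝ} {Fν : ℕ → E → Fin m → ℝ}
    (hF : ∀ (x : ℕ → E) (x0 : E), (∀ ν, x ν ∈ C ν) → Tendsto x atTop (𝓝 x0) →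
      Tendsto (fun ν => Fν ν (x ν)) atTop (𝓝 (F x0))) :
    EpiConverges (fun ν x => if x ∈ C ν then hν ν (Fν ν x) else ⊤)
      (fun x => if x ∈ C0 then ((h (F x) : ℝ) : EReal) else ⊤) := by
  constructor
  · intro z z0 hz
    by_cases hz0 : z0 ∈ C0
    · obtain ⟨e, heC, he⟩ := hC.2 z0 hz0
      set y : ℕ → E := fun ν => if z ν ∈ C ν then z ν else e ν with hy
      have hyC : ∀ ν, y ν ∈ C ν := fun ν => by
        by_cases hmem : z ν ∈ C ν
        · simpa only [hy, if_pos hmem] using hmem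
        · simpa only [hy, if_neg hmem] using heC ν
      have hylim := hepi.tendsto_of_convex hcvx hνlsc hνcvx (hF y z0 hyC (hz.if' he))
      simp only [if_pos hz0]
      rw [← hylim.liminf_eq]
      refine liminf_le_liminf (Eventually.of_forall fun ν => ?_)
      by_cases hmem : z ν ∈ C ν
      · simp [hy, hmem]
      · simp [hmem]
    · have hev : ∀ᶠ ν in atTop, z ν ∉ C ν := by
        by_contra hfreq
        obtain ⟨N, hN, hmem⟩ := extraction_of_frequently_atTop (not_eventually.1 hfreq)
        exact hz0 (hC.1 N _ z0 hN (fun k => not_not.1 (hmem k)) (hz.comp hN.tendsto_atTop))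
      have : Tendsto (fun ν => if z ν ∈ C ν then hν ν (Fν ν (z ν)) else ⊤) atTop
          (𝓝 (⊤ : EReal)) :=
        tendsto_const_nhds.congr' (hev.mono fun ν hmem => (if_neg hmem).symm)
      rw [this.liminf_eq]
      exact le_top
  · intro z0
    by_cases hz0 : z0 ∈ C0
    · obtain ⟨e, heC, he⟩ := hC.2 z0 hz0
      refine ⟨e, he, ?_⟩
      simp only [if_pos hz0, if_pos (heC _)]
      exact (hepi.tendsto_of_convex hcvx hνlsc hνcvx (hF e z0 heC he)).limsup_eq.le
    · exact ⟨fun _ => z0, tendsto_const_nhds, by simp [hz0]⟩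

/-- consistency of the approximations in the smooth case — epi-convergence
of the composite objective functions and graphical convergence of the
optimality-condition mappings. -/
theorem smooth_case_consistency
    (n m : ℕ)
    (X : Set (EuclideanSpace ℝ (Fin n))) (Xν : ℕ → Set (EuclideanSpace ℝ (Fin n)))
    (hXne : X.Nonempty) (hXcl : IsClosed X) (hXcv : Convex ℝ X)
    (hXνne : ∀ ν, (Xν ν).Nonempty) (hXνcl : ∀ ν, IsClosed (Xν ν))
    (hXνcv : ∀ ν, Convex ℝ (Xν ν))
    (hXconv : SetConverges Xν X)
    (h : (Fin m → ℝ) → ℝ) (hcvx : ConvexOn ℝ Set.univ h)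
    (hν : ℕ → (Fin m → ℝ) → EReal)
    (hνbot : ∀ ν z, hν ν z ≠ ⊥) (hνproper : ∀ ν, ∃ z, hν ν z ≠ ⊤)
    (hνlsc : ∀ ν, IsClosed (EpiSet (hν ν))) (hνcvx : ∀ ν, Convex ℝ (EpiSet (hν ν)))
    (hepi : EpiConverges hν (fun z => ((h z : ℝ) : EReal)))
    (f : Fin m → EuclideanSpace ℝ (Fin n) → ℝ)
    (fν : ℕ → Fin m → EuclideanSpace ℝ (Fin n) → ℝ)
    (hf : ∀ i, ContDiff ℝ 1 (f i)) (hfν : ∀ ν i, ContDiff ℝ 1 (fν ν i))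
    (hfconv : ∀ (x : ℕ → EuclideanSpace ℝ (Fin n)) (x0 : EuclideanSpace ℝ (Fin n)),
      (∀ ν, x ν ∈ Xν ν) → Tendsto x atTop (𝓝 x0) →
      ∀ i, Tendsto (fun ν => fν ν i (x ν)) atTop (𝓝 (f i x0)) ∧
        Tendsto (fun ν => gradient (fν ν i) (x ν)) atTop (𝓝 (gradient (f i) x0))) :
    EpiConverges
      (fun ν x => if x ∈ Xν ν then hν ν (fun i => fν ν i x) else ⊤)
      (fun x => if x ∈ X then ((h (fun i => f i x) : ℝ) : EReal) else ⊤) ∧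
    SetConverges
      (fun ν => GphS (fun x i => fν ν i x) (fun x i => gradient (fν ν i) x)
        (SubdiffE (hν ν)) (Xν ν))
      (GphS (fun x i => f i x) (fun x i => gradient (f i) x) (SubdiffR h) X) := by
  have hFlim : ∀ (x : ℕ → EuclideanSpace ℝ (Fin n)) (x0 : EuclideanSpace ℝ (Fin n)),
      (∀ ν, x ν ∈ Xν ν) → Tendsto x atTop (𝓝 x0) →
      Tendsto (fun ν i => fν ν i (x ν)) atTop (𝓝 fun i => f i x0) := fun x x0 hx hlim =>
    tendsto_pi_nhds.2 fun i => (hfconv x x0 hx hlim i).1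
  have hGlim : ∀ (x : ℕ → EuclideanSpace ℝ (Fin n)) (x0 : EuclideanSpace ℝ (Fin n)),
      (∀ ν, x ν ∈ Xν ν) → Tendsto x atTop (𝓝 x0) →
      Tendsto (fun ν i => gradient (fν ν i) (x ν)) atTop (𝓝 fun i => gradient (f i) x0) :=
    fun x x0 hx hlim => tendsto_pi_nhds.2 fun i => (hfconv x x0 hx hlim i).2
  have hsum : ∀ {y : ℕ → Fin m → ℝ} {y0 : Fin m → ℝ}
      {G : ℕ → Fin m → EuclideanSpace ℝ (Fin n)} {G0 : Fin m → EuclideanSpace ℝ (Fin n)},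
      Tendsto y atTop (𝓝 y0) → Tendsto G atTop (𝓝 G0) →
      Tendsto (fun k => ∑ i, y k i • G k i) atTop (𝓝 (∑ i, y0 i • G0 i)) := fun hy hG =>
    tendsto_finsetSum _ fun i _ => (tendsto_pi_nhds.1 hy i).smul (tendsto_pi_nhds.1 hG i)
  refine ⟨hepi.comp_restrict hXconv hcvx hνlsc hνcvx (F := fun x i => f i x)
    (Fν := fun ν x i => fν ν i x) hFlim, ?_, ?_⟩
  · rintro N q ⟨⟨x0, y0, z0⟩, u0, v0, w0⟩ hN hq hlim
    have hx := (((continuous_fst.comp continuous_fst).tendsto _).comp hlim)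
    have hy := ((continuous_fst.comp (continuous_snd.comp continuous_fst)).tendsto _).comp hlim
    have hz := ((continuous_snd.comp (continuous_snd.comp continuous_fst)).tendsto _).comp hlim
    have hu := ((continuous_fst.comp continuous_snd).tendsto _).comp hlim
    have hv := ((continuous_fst.comp (continuous_snd.comp continuous_snd)).tendsto _).comp hlim
    have hw := ((continuous_snd.comp (continuous_snd.comp continuous_snd)).tendsto _).comp hlim
    simp only [Function.comp_def] at hx hy hz hu hv hw
    have hqX : ∀ k, (q k).1.1 ∈ Xν (N k) := fun k => (hq k).2.2.1
    have hx0 : x0 ∈ X := hXconv.1 N _ x0 hN hqX hx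
    obtain ⟨e, heX, he⟩ := hXconv.2 x0 hx0
    have hF := tendsto_subseq_of_tendsto_extend (g := fun ν x i => fν ν i x)
      (fun x => hFlim x x0) heX he hN hqX hx
    have hG := tendsto_subseq_of_tendsto_extend (g := fun ν x i => gradient (fν ν i) x)
      (fun x => hGlim x x0) heX he hN hqX hx
    exact ⟨tendsto_nhds_unique hu ((hF.sub hz).congr fun k => (hq k).1.symm),
      hepi.mem_subdiffR_of_tendsto hcvx hνlsc hνcvx hN (fun k => (hq k).2.1) hz (hv.add hy),
      hXconv.mem_normalCone_of_tendsto hN (fun k => (hq k).2.2) hx (hw.sub (hsum hy hG))⟩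
  · rintro ⟨⟨x0, y0, z0⟩, u0, v0, w0⟩ ⟨hu, hv, hw⟩
    simp only at hu hv hw
    obtain ⟨z, s, hs, hz, hslim⟩ :=
      hepi.exists_tendsto_subdiffE hcvx hνbot hνproper hνlsc hνcvx hv
    obtain ⟨x, t, ht, hx, htlim⟩ :=
      hXconv.exists_tendsto_normal hXνne hXνcl hXνcv hw.1 hw.2
    have hF := hFlim x x0 (fun ν => (ht ν).1) hx
    have hG := hsum (tendsto_const_nhds (x := y0)) (hGlim x x0 (fun ν => (ht ν).1) hx)
    refine ⟨fun ν => ((x ν, y0, z ν), (fun i => fν ν i (x ν)) - z ν, s ν - y0,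
      t ν + ∑ i, y0 i • gradient (fν ν i) (x ν)), fun ν => ⟨rfl, ?_, ?_⟩, ?_⟩
    · simpa using hs ν
    · simpa [NormalCone] using ht ν
    · refine (hx.prodMk_nhds (tendsto_const_nhds.prodMk_nhds hz)).prodMk_nhds
        (Tendsto.prodMk_nhds ?_ (Tendsto.prodMk_nhds ?_ ?_))
      · rw [hu]
        exact hF.sub hz
      · simpa using hslim.sub (tendsto_const_nhds (x := y0))
      · simpa using htlim.add hG
end
end

section
/- (Augmented Lagrangian approximation, Example 4.) Let m ≥ 2, let {y^ν = (y_2^ν, …, y_m^ν) ∈ ℝ^{m−1}, ν ∈ ℕ} be a bounded sequence, and let θ^ν ∈ [0,∞) with θ^ν → ∞. Define h(z) = z_1 if z_2 = ⋯ = z_m = 0 and h(z) = +∞ otherwise, and h^ν(z) = z_1 + Σ_{i=2}^m ( y_i^ν z_i + (θ^ν/2) z_i² ). Then h^ν epi-converges to h. -/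
open Filter Topology
open scoped Classical

noncomputable section

/-- A uniform lower bound for linear-plus-quadratic penalties with bounded multipliers. -/
lemma neg_abs_add_sq_le_penalty {ι : Type*} [Fintype ι] {C t : ℝ} {y : ι → ℝ}
    (hy : ∀ i, |y i| ≤ C) (w : ι → ℝ) :
    -(C * ∑ i, |w i|) + t / 2 * ∑ i, w i ^ 2 ≤ ∑ i, (y i * w i + t / 2 * w i ^ 2) := by
  rw [Finset.mul_sum, Finset.mul_sum, ← Finset.sum_neg_distrib, ← Finset.sum_add_distrib]
  refine Finset.sum_le_sum fun i _ => ?_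
  have h₁ : |y i * w i| ≤ C * |w i| := by
    rw [abs_mul]
    exact mul_le_mul_of_nonneg_right (hy i) (abs_nonneg _)
  linarith [neg_abs_le (y i * w i)]

/-- augmented Lagrangian approximations epi-converge to the function
encoding the equality constraints.  Here ℝ^m (m ≥ 2) is modeled as ℝ × ℝ^{m−1},
with first coordinate z₁ and remaining coordinates z₂, …, z_m. -/
theorem augmented_lagrangian_epi_convergence
    (k : ℕ) (hk : 1 ≤ k)
    (y : ℕ → Fin k → ℝ) (hybd : ∃ C : ℝ, ∀ ν i, |y ν i| ≤ C)
    (θ : ℕ → ℝ) (hθ0 : ∀ ν, 0 ≤ θ ν) (hθ : Tendsto θ atTop atTop) :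
    EpiConverges
      (fun ν (z : ℝ × (Fin k → ℝ)) =>
        ((z.1 + ∑ i, (y ν i * z.2 i + θ ν / 2 * (z.2 i) ^ 2) : ℝ) : EReal))
      (fun (z : ℝ × (Fin k → ℝ)) => if z.2 = 0 then ((z.1 : ℝ) : EReal) else ⊤) := by
  obtain ⟨C, hC⟩ := hybd
  refine ⟨fun z z0 hz => ?_, fun z0 => ⟨fun _ => z0, tendsto_const_nhds, ?_⟩⟩
  · have hlin : Tendsto (fun ν => (z ν).1 + -(C * ∑ i, |(z ν).2 i|)) atTop
        (𝓝 (z0.1 + -(C * ∑ i, |z0.2 i|))) :=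
      ((by fun_prop : Continuous fun p : ℝ × (Fin k → ℝ) =>
        p.1 + -(C * ∑ i, |p.2 i|)).tendsto z0).comp hz
    have hsq : Tendsto (fun ν => ∑ i, (z ν).2 i ^ 2) atTop (𝓝 (∑ i, z0.2 i ^ 2)) :=
      ((by fun_prop : Continuous fun p : ℝ × (Fin k → ℝ) => ∑ i, p.2 i ^ 2).tendsto z0).comp hz
    have hle := fun ν => neg_abs_add_sq_le_penalty (t := θ ν) (hC ν) (z ν).2
    by_cases h0 : z0.2 = 0
    · simp only [h0, if_true]
      have hlim : Tendsto (fun ν => (((z ν).1 + -(C * ∑ i, |(z ν).2 i|) : ℝ) : EReal)) atTop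
          (𝓝 (z0.1 : EReal)) := by
        simp only [h0, Pi.zero_apply, abs_zero, Finset.sum_const_zero, mul_zero, neg_zero,
          add_zero] at hlin
        exact (continuous_coe_real_ereal.tendsto _).comp hlin
      rw [← hlim.liminf_eq]
      refine liminf_le_liminf (Eventually.of_forall fun ν => EReal.coe_le_coe_iff.2 ?_)
      have : 0 ≤ θ ν / 2 * ∑ i, (z ν).2 i ^ 2 :=
        mul_nonneg (by linarith [hθ0 ν]) (Finset.sum_nonneg fun i _ => sq_nonneg _)
      linarith [hle ν]
    · simp only [h0, if_false]
      have hpos : 0 < ∑ i, z0.2 i ^ 2 := by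
        obtain ⟨j, hj⟩ := Function.ne_iff.1 h0
        exact Finset.sum_pos' (fun i _ => sq_nonneg _) ⟨j, Finset.mem_univ _, by
          have : z0.2 j ≠ 0 := hj
          positivity⟩
      have htop := hlin.add_atTop ((hθ.atTop_div_const two_pos).atTop_mul_pos hpos hsq)
      refine (EReal.tendsto_coe_nhds_top_iff.2
        (tendsto_atTop_mono (fun ν => ?_) htop)).liminf_eq.ge
      linarith [hle ν]
  · by_cases h0 : z0.2 = 0 <;> simp [h0]
end
end

section
/- (Log-sum-exp smoothing of min-functions, Example 5.) Let g_1, …, g_s : ℝⁿ → ℝ be continuously differentiable, let f(x) = min_{k=1,…,s} g_k(x), and for θ^ν ∈ (0,∞) with θ^ν → ∞ define f^ν(x) = −(1/θ^ν) ln( Σ_{k=1}^s exp(−θ^ν g_k(x)) ). Then for every sequence x^ν → x̄ in ℝⁿ: (i) f^ν(x^ν) → f(x̄); (ii) the sequence of gradients {∇f^ν(x^ν)} is bounded; and (iii) every cluster point of {∇f^ν(x^ν)} lies in the convex hull of {∇g_k(x̄) : k ∈ argmin_{j=1,…,s} g_j(x̄)}. -/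
open Filter Topology

noncomputable section

/-- The Gibbs weights `exp (-t aₖ) / ∑ⱼ exp (-t aⱼ)`, concentrated near the minimum of `a` for
large `t`. -/
def softminWeight {ι : Type*} [Fintype ι] (t : ℝ) (a : ι → ℝ) (k : ι) : ℝ :=
  Real.exp (-t * a k) / ∑ j, Real.exp (-t * a j)

section Weights

variable {ι : Type*} [Fintype ι]

theorem sum_exp_pos [Nonempty ι] (b : ι → ℝ) : 0 < ∑ j, Real.exp (b j) :=
  Finset.sum_pos (fun _ _ => Real.exp_pos _) Finset.univ_nonempty

theorem softminWeight_mem_stdSimplex [Nonempty ι] (t : ℝ) (a : ι → ℝ) :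
    softminWeight t a ∈ stdSimplex ℝ ι := by
  refine ⟨fun k => div_nonneg (Real.exp_pos _).le (sum_exp_pos _).le, ?_⟩
  simp only [softminWeight, ← Finset.sum_div]
  exact div_self (sum_exp_pos _).ne'

theorem softminWeight_le_exp (t : ℝ) (a : ι → ℝ) (j k : ι) :
    softminWeight t a k ≤ Real.exp (-(t * (a k - a j))) := by
  have h : Real.exp (-t * a j) ≤ ∑ i, Real.exp (-t * a i) :=
    Finset.single_le_sum (f := fun i => Real.exp (-t * a i))
      (fun _ _ => (Real.exp_pos _).le) (Finset.mem_univ j)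
  calc softminWeight t a k ≤ Real.exp (-t * a k) / Real.exp (-t * a j) :=
        div_le_div_of_nonneg_left (Real.exp_pos _).le (Real.exp_pos _) h
    _ = Real.exp (-(t * (a k - a j))) := by rw [← Real.exp_sub]; ring_nf

theorem tendsto_softminWeight_zero [Nonempty ι] {α : Type*} {l : Filter α} {θ : α → ℝ}
    {a : α → ι → ℝ} {b : ι → ℝ} (hθ : Tendsto θ l atTop) (ha : Tendsto a l (𝓝 b))
    {j k : ι} (hjk : b j < b k) :
    Tendsto (fun ν => softminWeight (θ ν) (a ν) k) l (𝓝 0) := by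
  have hd : Tendsto (fun ν => a ν k - a ν j) l (𝓝 (b k - b j)) :=
    (tendsto_pi_nhds.1 ha k).sub (tendsto_pi_nhds.1 ha j)
  have hexp : Tendsto (fun ν => Real.exp (-(θ ν * (a ν k - a ν j)))) l (𝓝 0) :=
    Real.tendsto_exp_neg_atTop_nhds_zero.comp (hθ.atTop_mul_pos (sub_pos.2 hjk) hd)
  exact squeeze_zero (fun ν => (softminWeight_mem_stdSimplex _ _).1 k)
    (fun ν => softminWeight_le_exp _ _ j k) hexp

theorem neg_log_sum_exp_le {t m : ℝ} (ht : 0 < t) {a : ι → ℝ}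
    (hm : IsLeast (Set.range a) m) :
    -(1 / t) * Real.log (∑ k, Real.exp (-t * a k)) ≤ m := by
  obtain ⟨j, rfl⟩ := hm.1
  have h : Real.exp (-t * a j) ≤ ∑ i, Real.exp (-t * a i) :=
    Finset.single_le_sum (f := fun i => Real.exp (-t * a i))
      (fun _ _ => (Real.exp_pos _).le) (Finset.mem_univ j)
  have hlog : -t * a j ≤ Real.log (∑ i, Real.exp (-t * a i)) :=
    (Real.le_log_iff_exp_le ((Real.exp_pos _).trans_le h)).2 h
  rw [neg_mul, one_div_mul_eq_div, neg_le, le_div_iff₀ ht]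
  linarith

theorem sub_log_card_div_le_neg_log_sum_exp {t m : ℝ} (ht : 0 < t) {a : ι → ℝ}
    (hm : IsLeast (Set.range a) m) :
    m - Real.log (Fintype.card ι) / t ≤ -(1 / t) * Real.log (∑ k, Real.exp (-t * a k)) := by
  have : Nonempty ι := ⟨hm.1.choose⟩
  have hcard : (0 : ℝ) < Fintype.card ι := by exact_mod_cast Fintype.card_pos
  have h : ∑ k, Real.exp (-t * a k) ≤ Fintype.card ι * Real.exp (-t * m) := by
    have := Finset.sum_le_card_nsmul Finset.univ (fun k => Real.exp (-t * a k))
      (Real.exp (-t * m)) fun k _ => Real.exp_le_exp.2 <|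
        mul_le_mul_of_nonpos_left (hm.2 ⟨k, rfl⟩) (neg_nonpos.2 ht.le)
    simpa [nsmul_eq_mul] using this
  have hlog := Real.log_le_log (sum_exp_pos _) h
  rw [Real.log_mul hcard.ne' (Real.exp_pos _).ne', Real.log_exp] at hlog
  rw [neg_mul, one_div_mul_eq_div, sub_le_iff_le_add, neg_add_eq_sub, ← sub_div,
    le_div_iff₀ ht]
  linarith

end Weights

theorem continuous_of_isLeast_range {ι X : Type*} [Fintype ι] [Nonempty ι] [TopologicalSpace X]
    {g : ι → X → ℝ} (hg : ∀ k, Continuous (g k)) {f : X → ℝ}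
    (hf : ∀ x, IsLeast (Set.range fun k => g k x) (f x)) : Continuous f := by
  have h : f = fun x => Finset.univ.inf' Finset.univ_nonempty fun k => g k x := by
    funext x
    obtain ⟨j, hj⟩ := (hf x).1
    refine le_antisymm (Finset.le_inf' _ _ fun k _ => (hf x).2 ⟨k, rfl⟩) ?_
    rw [← hj]
    exact Finset.inf'_le (fun k => g k x) (Finset.mem_univ j)
  rw [h]
  exact Continuous.finset_inf'_apply _ fun k _ => hg k

theorem hasGradientAt_neg_log_sum_exp {ι E : Type*} [Fintype ι] [Nonempty ι]
    [NormedAddCommGroup E] [InnerProductSpace ℝ E] [CompleteSpace E] {t : ℝ} (ht : t ≠ 0)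
    {g : ι → E → ℝ} {x : E} (hg : ∀ k, DifferentiableAt ℝ (g k) x) :
    HasGradientAt (fun w => -(1 / t) * Real.log (∑ k, Real.exp (-t * g k w)))
      (∑ k, softminWeight t (fun j => g j x) k • gradient (g k) x) x := by
  have hsum : HasFDerivAt (fun w => ∑ k, Real.exp (-t * g k w))
      (∑ k, Real.exp (-t * g k x) • (-t) • InnerProductSpace.toDual ℝ E (gradient (g k) x)) x :=
    HasFDerivAt.fun_sum fun k _ => ((hg k).hasGradientAt.hasFDerivAt.const_mul (-t)).exp
  have h := (hsum.log (sum_exp_pos _).ne').const_mul (-(1 / t))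
  rw [hasGradientAt_iff_hasFDerivAt]
  refine h.congr_fderiv (Eq.symm ?_)
  simp only [map_sum, map_smulₛₗ, conj_trivial, Finset.smul_sum, smul_smul]
  refine Finset.sum_congr rfl fun k _ => ?_
  congr 1
  simp only [softminWeight]
  field_simp

theorem ContDiff.continuous_gradient {E : Type*} [NormedAddCommGroup E] [InnerProductSpace ℝ E]
    [CompleteSpace E] {g : E → ℝ} (hg : ContDiff ℝ 1 g) : Continuous (gradient g) :=
  (InnerProductSpace.toDual ℝ E).symm.continuous.comp (hg.continuous_fderiv one_ne_zero)

theorem mem_convexHull_image_of_ultrafilter {ι α E : Type*} [Fintype ι] [NormedAddCommGroup E]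
    [NormedSpace ℝ E] {U : Ultrafilter α} {w : α → ι → ℝ} (hw : ∀ ν, w ν ∈ stdSimplex ℝ ι)
    {u : α → ι → E} {v : ι → E} (hu : ∀ k, Tendsto (fun ν => u ν k) U (𝓝 (v k)))
    {A : Set ι} (hA : ∀ k ∉ A, Tendsto (fun ν => w ν k) U (𝓝 0)) {y : E}
    (hy : Tendsto (fun ν => ∑ k, w ν k • u ν k) U (𝓝 y)) :
    y ∈ convexHull ℝ (v '' A) := by
  obtain ⟨p, hp, hwp⟩ := (isCompact_stdSimplex ℝ ι).ultrafilter_le_nhds (U.map w)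
    (tendsto_principal.2 (Eventually.of_forall hw))
  have hwk : ∀ k, Tendsto (fun ν => w ν k) U (𝓝 (p k)) := tendsto_pi_nhds.1 hwp
  have hyp : y = ∑ k, p k • v k :=
    tendsto_nhds_unique hy (tendsto_finsetSum _ fun k _ => (hwk k).smul (hu k))
  have hmem := (convex_convexHull ℝ (v '' A)).finsum_mem (w := p) (z := v) hp.1
    (by rw [finsum_eq_sum_of_fintype]; exact hp.2) fun k hk =>
      subset_convexHull ℝ _ ⟨k, by_contra fun hkA =>
        hk (tendsto_nhds_unique (hwk k) (hA k hkA)), rfl⟩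
  rwa [hyp, ← finsum_eq_sum_of_fintype]

theorem isBounded_range_sum_smul {ι E : Type*} [Fintype ι] [NormedAddCommGroup E]
    [NormedSpace ℝ E] {w : ℕ → ι → ℝ} (hw : ∀ ν, w ν ∈ stdSimplex ℝ ι)
    {u : ℕ → ι → E} {v : ι → E} (hu : ∀ k, Tendsto (fun ν => u ν k) atTop (𝓝 (v k))) :
    Bornology.IsBounded (Set.range fun ν => ∑ k, w ν k • u ν k) := by
  obtain ⟨C, hC⟩ := (tendsto_finsetSum Finset.univ fun k _ => (hu k).norm).bddAbove_range
  refine isBounded_iff_forall_norm_le.2 ⟨C, ?_⟩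
  rintro _ ⟨ν, rfl⟩
  refine (norm_sum_le_of_le _ fun k _ => ?_).trans (hC ⟨ν, rfl⟩)
  rw [norm_smul, Real.norm_of_nonneg ((hw ν).1 k)]
  exact mul_le_of_le_one_left (norm_nonneg _) ((mem_Icc_of_mem_stdSimplex (hw ν) k).2)

/-- log-sum-exp smoothing of a min-function — convergence of values,
boundedness of gradients, and localization of gradient cluster points in the convex
hull of the gradients of the active pieces. -/
theorem log_sum_exp_smoothing_of_min
    (n s : ℕ) (hs : 0 < s)
    (g : Fin s → EuclideanSpace ℝ (Fin n) → ℝ) (hg : ∀ k, ContDiff ℝ 1 (g k))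
    (θ : ℕ → ℝ) (hθpos : ∀ ν, 0 < θ ν) (hθ : Tendsto θ atTop atTop)
    (f : EuclideanSpace ℝ (Fin n) → ℝ)
    (hf : ∀ x, IsLeast (Set.range fun k => g k x) (f x))
    (x : ℕ → EuclideanSpace ℝ (Fin n)) (xb : EuclideanSpace ℝ (Fin n))
    (hx : Tendsto x atTop (𝓝 xb)) :
    Tendsto (fun ν => -(1 / θ ν) * Real.log (∑ k, Real.exp (-(θ ν) * g k (x ν))))
      atTop (𝓝 (f xb)) ∧
    Bornology.IsBounded (Set.range fun ν =>
      gradient (fun w => -(1 / θ ν) * Real.log (∑ k, Real.exp (-(θ ν) * g k w))) (x ν)) ∧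
    ∀ vb, MapClusterPt vb atTop (fun ν =>
        gradient (fun w => -(1 / θ ν) * Real.log (∑ k, Real.exp (-(θ ν) * g k w))) (x ν)) →
      vb ∈ convexHull ℝ ((fun k => gradient (g k) xb) '' {k | ∀ j, g k xb ≤ g j xb}) := by

  have : Nonempty (Fin s) := ⟨⟨0, hs⟩⟩
  have hgx : ∀ k, Tendsto (fun ν => g k (x ν)) atTop (𝓝 (g k xb)) := fun k =>
    ((hg k).continuous.tendsto xb).comp hx
  have hgrad : ∀ k, Tendsto (fun ν => gradient (g k) (x ν)) atTop (𝓝 (gradient (g k) xb)) :=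
    fun k => ((hg k).continuous_gradient.tendsto xb).comp hx
  have hform : ∀ ν,
      gradient (fun w => -(1 / θ ν) * Real.log (∑ k, Real.exp (-(θ ν) * g k w))) (x ν) =
        ∑ k, softminWeight (θ ν) (fun j => g j (x ν)) k • gradient (g k) (x ν) := fun ν =>
    (hasGradientAt_neg_log_sum_exp (hθpos ν).ne' fun k =>
      ((hg k).differentiable one_ne_zero).differentiableAt).gradient
  have hw : ∀ ν, softminWeight (θ ν) (fun j => g j (x ν)) ∈ stdSimplex ℝ (Fin s) :=
    fun ν => softminWeight_mem_stdSimplex _ _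
  simp only [hform]
  refine ⟨?_, isBounded_range_sum_smul hw hgrad, fun vb hvb => ?_⟩
  · have hfx : Tendsto (fun ν => f (x ν)) atTop (𝓝 (f xb)) :=
      ((continuous_of_isLeast_range (fun k => (hg k).continuous) hf).tendsto xb).comp hx
    have hlow := hfx.sub (hθ.const_div_atTop (Real.log (Fintype.card (Fin s))))
    rw [sub_zero] at hlow
    exact tendsto_of_tendsto_of_tendsto_of_le_of_le hlow hfx
      (fun ν => sub_log_card_div_le_neg_log_sum_exp (hθpos ν) (hf (x ν)))
      fun ν => neg_log_sum_exp_le (hθpos ν) (hf (x ν))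
  · obtain ⟨U, hU, hUvb⟩ := mapClusterPt_iff_ultrafilter.1 hvb
    refine mem_convexHull_image_of_ultrafilter hw (fun k => (hgrad k).mono_left hU)
      (fun k hk => ?_) hUvb
    simp only [Set.mem_ofPred_eq, not_forall, not_le] at hk
    obtain ⟨j, hj⟩ := hk
    exact (tendsto_softminWeight_zero hθ (tendsto_pi_nhds.2 hgx) hj).mono_left hU
end
end

section
/- (Exactness of the ℓ1 penalty, Example 'exact penalty methods'.) Let m ≥ 2, θ ∈ [0,∞), and ρ ∈ [0,∞) with θ ≥ 2ρ. Define h(z) = z_1 if z_2 = ⋯ = z_m = 0 and h(z) = +∞ otherwise, and h^ν(z) = z_1 + θ Σ_{i=2}^m |z_i|. If z, v ∈ ℝᵐ satisfy v ∈ ∂h^ν(z) and max{‖z‖₂, ‖v‖₂} ≤ 2ρ, then z_2 = ⋯ = z_m = 0 and v ∈ ∂h(z). Consequently, gph ∂h^ν ∩ B(0, 2ρ) ⊂ gph ∂h, i.e., exs_{2ρ}(gph ∂h^ν; gph ∂h) = 0, where ℝᵐ × ℝᵐ carries the norm ‖(z, v)‖ = max{‖z‖₂, ‖v‖₂}. 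-/
open Filter Topology
open scoped Classical RealInnerProductSpace

noncomputable section

/-- Moving one coordinate of the argument of the `ℓ¹`-penalized function. -/
private lemma sum_abs_add_single {ι : Type*} [Fintype ι] [DecidableEq ι] {s : Finset ι}
    {i : ι} (hi : i ∈ s) (z : EuclideanSpace ℝ ι) (c : ℝ) :
    ∑ j ∈ s, |(z + EuclideanSpace.single i c) j| = ∑ j ∈ s, |z j| + (|z i + c| - |z i|) := by
  rw [← Finset.add_sum_erase s _ hi, ← Finset.add_sum_erase s (fun j => |z j|) hi]
  have hrest : ∑ j ∈ s.erase i, |(z + EuclideanSpace.single i c) j| = ∑ j ∈ s.erase i, |z j| :=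
    Finset.sum_congr rfl fun j hj => by simp [Finset.ne_of_mem_erase hj]
  rw [hrest]
  simp
  ring

private lemma sum_abs_add_single_of_notMem {ι : Type*} [Fintype ι] [DecidableEq ι]
    {s : Finset ι} {i : ι} (hi : i ∉ s) (z : EuclideanSpace ℝ ι) (c : ℝ) :
    ∑ j ∈ s, |(z + EuclideanSpace.single i c) j| = ∑ j ∈ s, |z j| :=
  Finset.sum_congr rfl fun j hj => by
    have hji : j ≠ i := fun h => hi (h ▸ hj)
    simp [hji]

private lemma sq_add_sq_le_norm_sq {ι : Type*} [Fintype ι] [DecidableEq ι] {i j : ι} (hij : i ≠ j)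
    (v : EuclideanSpace ℝ ι) : v i ^ 2 + v j ^ 2 ≤ ‖v‖ ^ 2 := by
  rw [EuclideanSpace.real_norm_sq_eq, ← Finset.sum_pair (f := fun k => v k ^ 2) hij]
  exact Finset.sum_le_sum_of_subset_of_nonneg (Finset.subset_univ _) fun _ _ _ => sq_nonneg _

section Penalty

variable {ι : Type*} [Fintype ι] [DecidableEq ι] {i₀ : ι} {θ : ℝ} {g : EuclideanSpace ℝ ι → ℝ}
  {z v : EuclideanSpace ℝ ι}

private lemma penalty_subgradient_apply_self
    (hg : ∀ z, g z = z i₀ + θ * ∑ i ∈ Finset.univ.erase i₀, |z i|)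
    (hv : ∀ w, g z + ⟪v, w - z⟫ ≤ g w) : v i₀ = 1 := by
  have key (c : ℝ) : c * v i₀ ≤ c := by
    have h := hv (z + EuclideanSpace.single i₀ c)
    rw [hg, hg, sum_abs_add_single_of_notMem (Finset.notMem_erase _ _), add_sub_cancel_left,
      EuclideanSpace.inner_single_right] at h
    simp at h
    linarith
  linarith [key 1, key (-1)]

private lemma le_abs_penalty_subgradient_apply
    (hg : ∀ z, g z = z i₀ + θ * ∑ i ∈ Finset.univ.erase i₀, |z i|)
    (hv : ∀ w, g z + ⟪v, w - z⟫ ≤ g w) {i : ι} (hi : i ≠ i₀) (hz : z i ≠ 0) : θ ≤ |v i| := by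
  have h := hv (z + EuclideanSpace.single i (-z i))
  rw [hg, hg, sum_abs_add_single (Finset.mem_erase.2 ⟨hi, Finset.mem_univ i⟩),
    add_sub_cancel_left, EuclideanSpace.inner_single_right] at h
  simp [hi.symm] at h
  refine le_of_mul_le_mul_right ?_ (abs_pos.2 hz)
  rw [← abs_mul]
  linarith [le_abs_self (v i * z i)]

private lemma eq_zero_of_penalty_subgradient
    (hg : ∀ z, g z = z i₀ + θ * ∑ i ∈ Finset.univ.erase i₀, |z i|) (hθ : 0 ≤ θ)
    (hv : ∀ w, g z + ⟪v, w - z⟫ ≤ g w) (hvθ : ‖v‖ ≤ θ) {i : ι} (hi : i ≠ i₀) : z i = 0 := by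
  by_contra hz
  have h₁ := penalty_subgradient_apply_self hg hv
  have h₂ := pow_le_pow_left₀ hθ (le_abs_penalty_subgradient_apply hg hv hi hz) 2
  have h₃ := pow_le_pow_left₀ (norm_nonneg v) hvθ 2
  have h₄ := sq_add_sq_le_norm_sq hi v
  rw [sq_abs] at h₂
  rw [h₁] at h₄
  linarith

end Penalty

private lemma subgradient_of_apply_eq_one {ι : Type*} [Fintype ι] {i₀ : ι}
    [∀ z : EuclideanSpace ℝ ι, Decidable (∀ i, i ≠ i₀ → z i = 0)]
    {h : EuclideanSpace ℝ ι → EReal}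
    (hh : ∀ z, h z = if (∀ i, i ≠ i₀ → z i = 0) then ((z i₀ : ℝ) : EReal) else ⊤)
    {z v : EuclideanSpace ℝ ι} (hz : ∀ i, i ≠ i₀ → z i = 0) (hv : v i₀ = 1)
    (w : EuclideanSpace ℝ ι) : h z + ((⟪v, w - z⟫ : ℝ) : EReal) ≤ h w := by
  rw [hh, hh, if_pos hz]
  split_ifs with hw
  · have hinner : ⟪v, w - z⟫ = w i₀ - z i₀ := by
      rw [PiLp.inner_apply, Finset.sum_eq_single i₀]
      · simp [hv]
      · intro i _ hi
        simp [hz i hi, hw i hi]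
      · simp
    rw [hinner, ← EReal.coe_add, add_sub_cancel]
  · exact le_top

/-- exactness of the ℓ1 penalty — for θ ≥ 2ρ, points of the graph of
∂h^ν within the ball of radius 2ρ belong to the graph of ∂h, so the truncated excess
of gph ∂h^ν over gph ∂h vanishes. -/
theorem exact_penalty_exactness
    (m : ℕ) (hm : 2 ≤ m) (i0 : Fin m) (hi0 : (i0 : ℕ) = 0)
    (θ ρ : ℝ) (hθ0 : 0 ≤ θ) (hρ0 : 0 ≤ ρ) (hθρ : 2 * ρ ≤ θ)
    (h : EuclideanSpace ℝ (Fin m) → EReal)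
    (hdef : ∀ z, h z = if (∀ i, i ≠ i0 → z i = 0) then ((z i0 : ℝ) : EReal) else ⊤)
    (hpen : EuclideanSpace ℝ (Fin m) → ℝ)
    (hpendef : ∀ z, hpen z = z i0 + θ * ∑ i ∈ Finset.univ.erase i0, |z i|) :
    (∀ z v : EuclideanSpace ℝ (Fin m),
      (∀ w, hpen z + ⟪v, w - z⟫ ≤ hpen w) →
      max ‖z‖ ‖v‖ ≤ 2 * ρ →
      (∀ i, i ≠ i0 → z i = 0) ∧ (∀ w, h z + ((⟪v, w - z⟫ : ℝ) : EReal) ≤ h w)) ∧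
    ({q : EuclideanSpace ℝ (Fin m) × EuclideanSpace ℝ (Fin m) |
        ∀ w, hpen q.1 + ⟪q.2, w - q.1⟫ ≤ hpen w} ∩ Metric.closedBall 0 (2 * ρ) ⊆
      {q : EuclideanSpace ℝ (Fin m) × EuclideanSpace ℝ (Fin m) |
        ∀ w, h q.1 + ((⟪q.2, w - q.1⟫ : ℝ) : EReal) ≤ h w}) ∧
    (⨆ q ∈ {q : EuclideanSpace ℝ (Fin m) × EuclideanSpace ℝ (Fin m) |
        ∀ w, hpen q.1 + ⟪q.2, w - q.1⟫ ≤ hpen w} ∩ Metric.closedBall 0 (2 * ρ),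
      EMetric.infEdist q {q' : EuclideanSpace ℝ (Fin m) × EuclideanSpace ℝ (Fin m) |
        ∀ w, h q'.1 + ((⟪q'.2, w - q'.1⟫ : ℝ) : EReal) ≤ h w}) = 0 := by
  have main : ∀ z v : EuclideanSpace ℝ (Fin m), (∀ w, hpen z + ⟪v, w - z⟫ ≤ hpen w) →
      max ‖z‖ ‖v‖ ≤ 2 * ρ →
      (∀ i, i ≠ i0 → z i = 0) ∧ (∀ w, h z + ((⟪v, w - z⟫ : ℝ) : EReal) ≤ h w) := by
    intro z v hv hmax
    have hz : ∀ i, i ≠ i0 → z i = 0 := fun i hi =>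
      eq_zero_of_penalty_subgradient hpendef hθ0 hv ((le_max_right _ _).trans (hmax.trans hθρ)) hi
    exact ⟨hz, subgradient_of_apply_eq_one hdef hz (penalty_subgradient_apply_self hpendef hv)⟩
  refine ⟨main, fun q hq => ?_, ?_⟩
  · exact (main q.1 q.2 hq.1 (mem_closedBall_zero_iff.1 hq.2)).2
  · simp only [ENNReal.iSup_eq_zero]
    intro q hq
    exact Metric.infEDist_zero_of_mem (main q.1 q.2 hq.1 (mem_closedBall_zero_iff.1 hq.2)).2
end
end
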